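/- arXiv:1903.06004 — 2 statements merged into one kernel-verified Lean document; each statement's English description precedes it below -/
import Mathlib

section
/- Let M be a random measure on a Polish space S and let 𝓘 be a countable topological dissecting semi-ring of bounded Borel sets generating the Borel σ-field of S. Then M is negatively associated as a random measure if and only if for every n ≥ 1 and all pairwise disjoint sets B_1, …, B_n ∈ 𝓘, the random vector (M(B_1), …, M(B_n)) is negatively associated in ℝ₊^n. -/
open MeasureTheory

/-- The partial order on (Radon) measures on a metric space:
`μ ≤ ν` iff `μ B ≤ ν B` for every bounded Borel set `B`. -/
def MeasLE {S : Type*} [MeasurableSpace S] [MetricSpace S] (μ ν : Measure S) : Prop :=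
  ∀ B : Set S, MeasurableSet B → Bornology.IsBounded B → μ B ≤ ν B

/-- A function on measures is nondecreasing w.r.t. the order `MeasLE`. -/
def MeasMono {S : Type*} [MeasurableSpace S] [MetricSpace S] (F : Measure S → ℝ) : Prop :=
  ∀ μ ν, MeasLE μ ν → F μ ≤ F ν

/-- A function on measures is measurable with respect to a set `A ⊆ S` if it only depends
on the restriction of its argument to `A`. -/
def MeasurableWrt {S : Type*} [MeasurableSpace S] (A : Set S) (F : Measure S → ℝ) : Prop :=
  ∀ μ : Measure S, F μ = F (μ.restrict A)

/-- A random measure `M` is *negatively associated* if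
`E[F(M) G(M)] ≤ E[F(M)] E[G(M)]` for every pair `F, G` of bounded nondecreasing measurable
functions on measures that are measurable with respect to disjoint measurable subsets of `S`. -/
def RMNegAssoc {Ω S : Type*} [MeasurableSpace Ω] [MeasurableSpace S] [MetricSpace S]
    (P : Measure Ω) (M : Ω → Measure S) : Prop :=
  ∀ (A B : Set S), MeasurableSet A → MeasurableSet B → Disjoint A B →
    ∀ F G : Measure S → ℝ,
      Measurable F → MeasMono F → (∃ C, ∀ μ, |F μ| ≤ C) → MeasurableWrt A F →
      Measurable G → MeasMono G → (∃ C, ∀ μ, |G μ| ≤ C) → MeasurableWrt B G →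
      ∫ ω, F (M ω) * G (M ω) ∂P ≤ (∫ ω, F (M ω) ∂P) * ∫ ω, G (M ω) ∂P

/-- A random measure `M` is *positively associated* if
`E[F(M) G(M)] ≥ E[F(M)] E[G(M)]` for every pair `F, G` of bounded nondecreasing
measurable functions on measures. -/
def RMPosAssoc {Ω S : Type*} [MeasurableSpace Ω] [MeasurableSpace S] [MetricSpace S]
    (P : Measure Ω) (M : Ω → Measure S) : Prop :=
  ∀ F G : Measure S → ℝ,
    Measurable F → MeasMono F → (∃ C, ∀ μ, |F μ| ≤ C) →
    Measurable G → MeasMono G → (∃ C, ∀ μ, |G μ| ≤ C) →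
    (∫ ω, F (M ω) ∂P) * ∫ ω, G (M ω) ∂P ≤ ∫ ω, F (M ω) * G (M ω) ∂P

/-- A countable topological dissecting semi-ring of bounded Borel sets generating the
Borel σ-field, as in Kallenberg's theory of random measures: a countable semi-ring of
bounded Borel sets such that every open set is a countable union of its members, every
bounded set is covered by finitely many of its members, and it generates the Borel
σ-field. -/
structure IsDissectingSemiring {S : Type*} [MeasurableSpace S] [MetricSpace S]
    (I : Set (Set S)) : Prop where
  countable : I.Countable
  measurableSet : ∀ B ∈ I, MeasurableSet B
  isBounded : ∀ B ∈ I, Bornology.IsBounded B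
  empty_mem : ∅ ∈ I
  inter_mem : ∀ A ∈ I, ∀ B ∈ I, A ∩ B ∈ I
  diff_eq_disjoint_sUnion : ∀ A ∈ I, ∀ B ∈ I, ∃ F : Finset (Set S),
    ↑F ⊆ I ∧ (F : Set (Set S)).Pairwise Disjoint ∧ A \ B = ⋃₀ ↑F
  isOpen_eq_sUnion : ∀ G : Set S, IsOpen G →
    ∃ C : Set (Set S), C ⊆ I ∧ C.Countable ∧ G = ⋃₀ C
  isBounded_covered : ∀ B : Set S, Bornology.IsBounded B →
    ∃ F : Finset (Set S), ↑F ⊆ I ∧ B ⊆ ⋃₀ ↑F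
  generateFrom_eq : MeasurableSpace.generateFrom I = ‹MeasurableSpace S›

/-- Negative association of finite-dimensional random vectors, with values in `ℝ≥0∞`. -/
def NegAssoc {Ω ι X : Type*} [MeasurableSpace Ω] [MeasurableSpace X] [Preorder X]
    (P : Measure Ω) (Xs : ι → Ω → X) : Prop :=
  ∀ (J : Set ι) (f : (J → X) → ℝ) (g : ((Jᶜ : Set ι) → X) → ℝ),
    Measurable f → Monotone f → (∃ C, ∀ x, |f x| ≤ C) →
    Measurable g → Monotone g → (∃ C, ∀ x, |g x| ≤ C) →
    ∫ ω, f (fun j => Xs j.1 ω) * g (fun j => Xs j.1 ω) ∂P ≤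
      (∫ ω, f (fun j => Xs j.1 ω) ∂P) * ∫ ω, g (fun j => Xs j.1 ω) ∂P

open Set Filter Topology
open scoped ENNReal

/-- The smallest family of sets containing `𝒜` and closed under limits of monotone and antitone
sequences. -/
inductive MonotoneClass {α : Type*} (𝒜 : Set (Set α)) : Set α → Prop
  | basic {A : Set α} : A ∈ 𝒜 → MonotoneClass 𝒜 A
  | iUnion {f : ℕ → Set α} : Monotone f → (∀ n, MonotoneClass 𝒜 (f n)) → MonotoneClass 𝒜 (⋃ n, f n)
  | iInter {f : ℕ → Set α} : Antitone f → (∀ n, MonotoneClass 𝒜 (f n)) → MonotoneClass 𝒜 (⋂ n, f n)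

namespace MonotoneClass

variable {α : Type*} {𝒜 : Set (Set α)}

theorem compl (h𝒜 : IsSetAlgebra 𝒜) {A : Set α} (hA : MonotoneClass 𝒜 A) :
    MonotoneClass 𝒜 Aᶜ := by
  induction hA with
  | basic h => exact .basic (h𝒜.compl_mem h)
  | iUnion hf _ ih =>
    rw [compl_iUnion]
    exact .iInter (fun i j h => compl_subset_compl.2 (hf h)) ih
  | iInter hf _ ih =>
    rw [compl_iInter]
    exact .iUnion (fun i j h => compl_subset_compl.2 (hf h)) ih

theorem inter_right {A : Set α} (h : ∀ B ∈ 𝒜, MonotoneClass 𝒜 (A ∩ B)) {B : Set α}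
    (hB : MonotoneClass 𝒜 B) : MonotoneClass 𝒜 (A ∩ B) := by
  induction hB with
  | basic hB => exact h _ hB
  | iUnion hf _ ih =>
    rw [inter_iUnion]
    exact .iUnion (fun i j h => inter_subset_inter_right _ (hf h)) ih
  | iInter hf _ ih =>
    rw [inter_iInter]
    exact .iInter (fun i j h => inter_subset_inter_right _ (hf h)) ih

theorem inter (h𝒜 : IsSetAlgebra 𝒜) {A B : Set α} (hA : MonotoneClass 𝒜 A)
    (hB : MonotoneClass 𝒜 B) : MonotoneClass 𝒜 (A ∩ B) := by
  refine inter_right (fun B hB => ?_) hB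
  rw [inter_comm]
  exact inter_right (fun A hA => .basic (h𝒜.inter_mem hB hA)) hA

theorem of_measurableSet [m : MeasurableSpace α] (h𝒜 : IsSetAlgebra 𝒜)
    (hgen : m = MeasurableSpace.generateFrom 𝒜) {A : Set α} (hA : MeasurableSet A) :
    MonotoneClass 𝒜 A := by
  subst hgen
  induction hA with
  | basic A hA => exact .basic hA
  | empty => exact .basic h𝒜.empty_mem
  | compl A _ ih => exact ih.compl h𝒜
  | iUnion f _ ih =>
    rw [← iUnion_accumulate]
    refine .iUnion monotone_accumulate fun n => ?_
    induction n with
    | zero => simpa [accumulate] using ih 0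
    | succ n hn =>
      rw [accumulate_succ, ← compl_compl (accumulate f n ∪ f (n + 1)), compl_union]
      exact ((hn.compl h𝒜).inter h𝒜 ((ih (n + 1)).compl h𝒜)).compl h𝒜

end MonotoneClass

/-- The sets whose traces on the members of a ring of sets belong to the ring. -/
def traceAlgebra {α : Type*} [MeasurableSpace α] (R : Set (Set α)) : Set (Set α) :=
  {A | MeasurableSet A ∧ ∀ E ∈ R, E ∩ A ∈ R}

theorem isSetAlgebra_traceAlgebra {α : Type*} [MeasurableSpace α] {R : Set (Set α)}
    (hR : IsSetRing R) : IsSetAlgebra (traceAlgebra R) where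
  empty_mem := ⟨.empty, fun E _ => by simpa using hR.empty_mem⟩
  compl_mem A hA := ⟨hA.1.compl, fun E hE => by
    rw [← sdiff_eq, ← sdiff_self_inter]
    exact hR.sdiff_mem hE (hA.2 E hE)⟩
  union_mem A B hA hB := ⟨hA.1.union hB.1, fun E hE => by
    rw [inter_union_distrib_left]
    exact hR.union_mem (hA.2 E hE) (hB.2 E hE)⟩

/-- A countable ring of sets generating the σ-algebra and covering the space by countably many
of its members. -/
structure IsGeneratingRing {S : Type*} [m : MeasurableSpace S] (R : Set (Set S)) : Prop where
  isSetRing : IsSetRing R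
  countable : R.Countable
  generateFrom_eq : m = MeasurableSpace.generateFrom R
  exists_cover : ∃ W : ℕ → Set S, (∀ n, W n ∈ R) ∧ ⋃ n, W n = univ

namespace IsGeneratingRing

variable {S : Type*} [m : MeasurableSpace S] {R : Set (Set S)}

theorem measurableSet (hR : IsGeneratingRing R) {E : Set S} (hE : E ∈ R) : MeasurableSet E := by
  rw [hR.generateFrom_eq]
  exact MeasurableSpace.measurableSet_generateFrom hE

/-- Monotone class theorem relative to a generating ring. -/
theorem monotone_class_induction (hR : IsGeneratingRing R) {p : Set S → Prop}
    (basic : ∀ A ∈ traceAlgebra R, p A)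
    (iUnion : ∀ f : ℕ → Set S, Monotone f → (∀ n, MeasurableSet (f n)) → (∀ n, p (f n)) →
      p (⋃ n, f n))
    (iInter : ∀ f : ℕ → Set S, Antitone f → (∀ n, MeasurableSet (f n)) → (∀ n, p (f n)) →
      p (⋂ n, f n))
    {A : Set S} (hA : MeasurableSet A) : p A := by
  have hgen : m = MeasurableSpace.generateFrom (traceAlgebra R) := by
    apply le_antisymm
    · conv_lhs => rw [hR.generateFrom_eq]
      exact MeasurableSpace.generateFrom_mono fun A hA =>
        ⟨hR.measurableSet hA, fun E hE => hR.isSetRing.inter_mem hE hA⟩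
    · exact MeasurableSpace.generateFrom_le fun A hA => hA.1
  have key := MonotoneClass.of_measurableSet (isSetAlgebra_traceAlgebra hR.isSetRing) hgen hA
  suffices h : MeasurableSet A ∧ p A from h.2
  clear hA
  induction key with
  | basic h => exact ⟨h.1, basic _ h⟩
  | iUnion hf _ ih => exact ⟨.iUnion fun n => (ih n).1, iUnion _ hf (fun n => (ih n).1)
      fun n => (ih n).2⟩
  | iInter hf _ ih => exact ⟨.iInter fun n => (ih n).1, iInter _ hf (fun n => (ih n).1)
      fun n => (ih n).2⟩

theorem exists_disjoint_cover (hR : IsGeneratingRing R) :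
    ∃ D : ℕ → Set S, (∀ n, D n ∈ R) ∧ Pairwise (Function.onFun Disjoint D) ∧ ⋃ n, D n = univ := by
  obtain ⟨W, hW, hU⟩ := hR.exists_cover
  exact ⟨disjointed W, hR.isSetRing.disjointed_mem hW, disjoint_disjointed W, by
    rw [iUnion_disjointed, hU]⟩

end IsGeneratingRing

/-- The values of a measure on a family of sets. -/
def valuesOn {S : Type*} [MeasurableSpace S] (R : Set (Set S)) (μ : Measure S) : R → ℝ≥0∞ :=
  fun E => μ E

/-- A measure is finite on a family of sets. -/
def FiniteOn {S : Type*} [MeasurableSpace S] (R : Set (Set S)) (μ : Measure S) : Prop :=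
  ∀ E ∈ R, μ E ≠ ∞

/-- The finitely additive functions on a ring of sets. -/
def additiveOn {S : Type*} (R : Set (Set S)) : Set (R → ℝ≥0∞) :=
  {x | (∀ E : R, E.1 = ∅ → x E = 0) ∧
    ∀ E F G : R, Disjoint E.1 F.1 → G.1 = E.1 ∪ F.1 → x G = x E + x F}

theorem isClosed_additiveOn {S : Type*} (R : Set (Set S)) : IsClosed (additiveOn R) := by
  simp only [additiveOn, ofPred_and, ofPred_forall]
  refine .inter ?_ ?_
  · exact isClosed_iInter fun E => isClosed_iInter fun _ =>
      isClosed_eq (continuous_apply E) continuous_const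
  · exact isClosed_iInter fun E => isClosed_iInter fun F => isClosed_iInter fun G =>
      isClosed_iInter fun _ => isClosed_iInter fun _ =>
        isClosed_eq (continuous_apply G) ((continuous_apply E).add (continuous_apply F))

section valuesOn

variable {S : Type*} [m : MeasurableSpace S] {R : Set (Set S)}

theorem tendsto_measure_inter_iUnion {μ : Measure S} {E : Set S} {f : ℕ → Set S}
    (hf : Monotone f) : Tendsto (fun n => μ (E ∩ f n)) atTop (𝓝 (μ (E ∩ ⋃ n, f n))) := by
  rw [inter_iUnion]
  exact tendsto_measure_iUnion_atTop fun i j h => inter_subset_inter_right _ (hf h)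

theorem tendsto_measure_inter_iInter {μ : Measure S} {E : Set S} {f : ℕ → Set S}
    (hμ : μ E ≠ ∞) (hE : MeasurableSet E) (hfm : ∀ n, MeasurableSet (f n)) (hf : Antitone f) :
    Tendsto (fun n => μ (E ∩ f n)) atTop (𝓝 (μ (E ∩ ⋂ n, f n))) := by
  rw [inter_iInter]
  exact tendsto_measure_iInter_atTop (fun n => (hE.inter (hfm n)).nullMeasurableSet)
    (fun i j h => inter_subset_inter_right _ (hf h))
    ⟨0, measure_ne_top_of_subset inter_subset_left hμ⟩

theorem measure_inter_le_of_valuesOn_le (hR : IsGeneratingRing R) {μ ν : Measure S}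
    (hμ : FiniteOn R μ) (hν : FiniteOn R ν) (h : valuesOn R μ ≤ valuesOn R ν)
    {A E : Set S} (hA : MeasurableSet A) (hE : E ∈ R) : μ (E ∩ A) ≤ ν (E ∩ A) := by
  refine hR.monotone_class_induction (p := fun A => μ (E ∩ A) ≤ ν (E ∩ A))
    (fun A hA => h ⟨_, hA.2 E hE⟩) (fun f hf _ ih => ?_) (fun f hf hfm ih => ?_) hA
  · exact le_of_tendsto_of_tendsto' (tendsto_measure_inter_iUnion hf)
      (tendsto_measure_inter_iUnion hf) ih
  · have hE' := hR.measurableSet hE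
    exact le_of_tendsto_of_tendsto' (tendsto_measure_inter_iInter (hμ E hE) hE' hfm hf)
      (tendsto_measure_inter_iInter (hν E hE) hE' hfm hf) ih

theorem valuesOn_mem_additiveOn (hR : IsGeneratingRing R) (μ : Measure S) :
    valuesOn R μ ∈ additiveOn R := by
  refine ⟨fun E hE => by simp [valuesOn, hE], fun E F G hEF hG => ?_⟩
  simp only [valuesOn, hG]
  exact measure_union hEF (hR.measurableSet F.2)

/-- A finitely additive function on a ring of sets dominated by a measure which is finite on the
ring is itself given by a measure. -/
theorem exists_measure_of_additiveOn (hR : IsGeneratingRing R) {ν : Measure S} (hν : FiniteOn R ν)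
    {x : R → ℝ≥0∞} (hx : x ∈ additiveOn R) (hxν : x ≤ valuesOn R ν) :
    ∃ μ : Measure S, FiniteOn R μ ∧ valuesOn R μ = x := by
  classical
  have hr := hR.isSetRing
  let c : AddContent ℝ≥0∞ R := hr.addContent_of_union (fun E => if h : E ∈ R then x ⟨E, h⟩ else 0)
    (by simp only [hr.empty_mem, dite_true]; exact hx.1 _ rfl)
    (fun {s t} hs ht hd => by
      simp only [hs, ht, hr.union_mem hs ht, dite_true]
      exact hx.2 _ _ _ hd rfl)
  have hc : ∀ E : R, c E = x E := fun E => dif_pos E.2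
  have hcν : ∀ E ∈ R, c E ≤ ν E := fun E hE => (hc ⟨E, hE⟩).trans_le (hxν _)
  have hsub : c.IsSigmaSubadditive := by
    refine isSigmaSubadditive_of_addContent_iUnion_eq_tsum hr
      (addContent_iUnion_eq_sum_of_tendsto_zero hr c
        (fun s hs => ne_top_of_le_ne_top (hν s hs) (hcν s hs)) fun s hs hanti hempty => ?_)
    have h := tendsto_measure_iInter_atTop (μ := ν)
      (fun n => (hR.measurableSet (hs n)).nullMeasurableSet) hanti ⟨0, hν _ (hs 0)⟩
    rw [hempty, measure_empty] at h
    exact tendsto_of_tendsto_of_tendsto_of_le_of_le tendsto_const_nhds h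
      (fun _ => zero_le) fun n => hcν _ (hs n)
  have hval : ∀ E : R, c.measure hr.isSetSemiring hR.generateFrom_eq.le hsub E = x E := fun E =>
    (c.measure_eq hr.isSetSemiring hR.generateFrom_eq hsub E.2).trans (hc E)
  refine ⟨c.measure hr.isSetSemiring hR.generateFrom_eq.le hsub, fun E hE => ?_, funext hval⟩
  rw [hval ⟨E, hE⟩]
  exact ne_top_of_le_ne_top (hν E hE) (hxν ⟨E, hE⟩)

theorem measurable_valuesOn (hR : IsGeneratingRing R) : Measurable (valuesOn R) :=
  measurable_pi_lambda _ fun E => Measure.measurable_coe (hR.measurableSet E.2)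

/-- On the measures which are finite on a generating ring, measurable sets of measures are
described by the values on the ring. -/
theorem exists_measurableSet_valuesOn (hR : IsGeneratingRing R) {U : Set (Measure S)}
    (hU : MeasurableSet U) :
    ∃ V : Set (R → ℝ≥0∞), MeasurableSet V ∧ ∀ μ, FiniteOn R μ → (μ ∈ U ↔ valuesOn R μ ∈ V) := by
  let L := {μ : Measure S // FiniteOn R μ}
  let mL : MeasurableSpace L := MeasurableSpace.comap (fun μ : L => valuesOn R μ.1) inferInstance
  have hval : Measurable (fun μ : L => valuesOn R μ.1) := comap_measurable _
  have hcoord : ∀ E ∈ R, Measurable (fun μ : L => μ.1 E) := fun E hE =>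
    (measurable_pi_apply (⟨E, hE⟩ : R)).comp hval
  obtain ⟨D, hD, hdisj, hcov⟩ := hR.exists_disjoint_cover
  have hDm := fun n => hR.measurableSet (hD n)
  have hmeas : Measurable (fun μ : L => μ.1) := by
    refine Measure.measurable_of_measurable_coe _ fun s hs => ?_
    have hrest : ∀ n, Measurable (fun μ : L => μ.1.restrict (D n)) := fun n => by
      have : ∀ μ : L, IsFiniteMeasure (μ.1.restrict (D n)) := fun μ =>
        ⟨by simpa using (μ.2 _ (hD n)).lt_top⟩
      refine Measurable.measure_of_isPiSystem hR.generateFrom_eq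
        hR.isSetRing.isSetSemiring.isPiSystem (fun E hE => ?_) ?_
      · simp only [Measure.restrict_apply (hR.measurableSet hE)]
        exact hcoord _ (hR.isSetRing.inter_mem hE (hD n))
      · simpa using hcoord _ (hD n)
    have hsum : (fun μ : L => μ.1 s) = fun μ : L => ∑' n, μ.1.restrict (D n) s := by
      funext μ
      simp only [Measure.restrict_apply hs]
      rw [← measure_iUnion (fun i j hij => (hdisj hij).mono inter_subset_right inter_subset_right)
        fun n => hs.inter (hDm n), ← inter_iUnion, hcov, inter_univ]
    rw [hsum]
    exact .tsum fun n => (Measure.measurable_coe hs).comp (hrest n)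
  obtain ⟨V, hV, hVU⟩ := hmeas hU
  exact ⟨V, hV, fun μ hμ => (Set.ext_iff.1 hVU ⟨μ, hμ⟩).symm⟩

end valuesOn

section separation

variable {ι : Type*} [Encodable ι]

/-- An increasing homeomorphism of `[0, ∞]` onto `[0, 1]`, as a real-valued function. -/
noncomputable def unitValue (y : ℝ≥0∞) : ℝ := ENNReal.orderIsoUnitIntervalBirational y

theorem unitValue_le_iff {y z : ℝ≥0∞} : unitValue y ≤ unitValue z ↔ y ≤ z := by
  simp only [unitValue, Subtype.coe_le_coe, OrderIso.le_iff_le]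

theorem continuous_unitValue : Continuous unitValue :=
  continuous_subtype_val.comp ENNReal.orderIsoUnitIntervalBirational.continuous

theorem unitValue_sub_le_one (y z : ℝ≥0∞) : unitValue y - unitValue z ≤ 1 := by
  unfold unitValue
  linarith [(ENNReal.orderIsoUnitIntervalBirational y).2.2,
    (ENNReal.orderIsoUnitIntervalBirational z).2.1]

/-- A weighted excess of `c` over `x` in a single coordinate. -/
noncomputable def excessTerm (x c : ι → ℝ≥0∞) (i : ι) : ℝ :=
  (1 / 2 : ℝ) ^ Encodable.encode i * max (unitValue (c i) - unitValue (x i)) 0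

/-- A weighted total excess of `c` over `x`. -/
noncomputable def excess (x c : ι → ℝ≥0∞) : ℝ := ∑' i, excessTerm x c i

theorem excessTerm_nonneg (x c : ι → ℝ≥0∞) (i : ι) : 0 ≤ excessTerm x c i := by
  unfold excessTerm
  positivity

theorem excessTerm_le (x c : ι → ℝ≥0∞) (i : ι) :
    excessTerm x c i ≤ (1 / 2 : ℝ) ^ Encodable.encode i :=
  mul_le_of_le_one_right (by positivity) (max_le (unitValue_sub_le_one _ _) zero_le_one)

theorem summable_excessTerm (x c : ι → ℝ≥0∞) : Summable (excessTerm x c) :=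
  .of_nonneg_of_le (excessTerm_nonneg x c) (excessTerm_le x c) summable_geometric_two_encode

theorem excess_nonneg (x c : ι → ℝ≥0∞) : 0 ≤ excess x c :=
  tsum_nonneg (excessTerm_nonneg x c)

theorem excess_eq_zero_iff {x c : ι → ℝ≥0∞} : excess x c = 0 ↔ c ≤ x := by
  rw [excess, ← (summable_excessTerm x c).hasSum_iff,
    hasSum_zero_iff_of_nonneg (excessTerm_nonneg x c), funext_iff]
  refine forall_congr' fun i => ?_
  simp [excessTerm, unitValue_le_iff]

theorem antitone_excess (c : ι → ℝ≥0∞) : Antitone fun x => excess x c := fun x y hxy => by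
  refine (summable_excessTerm y c).tsum_le_tsum (fun i => ?_) (summable_excessTerm x c)
  have := unitValue_le_iff.2 (hxy i)
  unfold excessTerm
  gcongr

theorem continuous_excess : Continuous fun p : (ι → ℝ≥0∞) × (ι → ℝ≥0∞) => excess p.1 p.2 := by
  refine continuous_tsum (u := fun i => (1 / 2 : ℝ) ^ Encodable.encode i) (fun i => ?_)
    summable_geometric_two_encode fun i p => ?_
  · have h := continuous_unitValue
    unfold excessTerm
    fun_prop
  · rw [Real.norm_of_nonneg (excessTerm_nonneg p.1 p.2 i)]
    exact excessTerm_le p.1 p.2 i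

/-- The indicator of the upper set generated by a compact set is a pointwise limit of continuous
monotone functions. -/
theorem exists_continuous_monotone_tendsto_indicator {K : Set (ι → ℝ≥0∞)} (hK : IsCompact K) :
    ∃ φ : ℕ → (ι → ℝ≥0∞) → ℝ, (∀ n, Continuous (φ n)) ∧ (∀ n, Monotone (φ n)) ∧
      (∀ n x, |φ n x| ≤ 1) ∧
      ∀ x, Tendsto (fun n => φ n x) atTop
        (𝓝 ((upperClosure K : Set (ι → ℝ≥0∞)).indicator 1 x)) := by
  classical
  rcases K.eq_empty_or_nonempty with rfl | hne
  · exact ⟨fun _ _ => 0, fun _ => continuous_const, fun _ => monotone_const, by simp, by simp⟩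
  let h : (ι → ℝ≥0∞) → ℝ := fun x => sInf (excess x '' K)
  have hcont : Continuous h := hK.continuous_sInf continuous_excess
  have hmin : ∀ x, ∃ c ∈ K, h x = excess x c := fun x =>
    hK.exists_sInf_image_eq hne (continuous_excess.comp (Continuous.prodMk_right x)).continuousOn
  have hle : ∀ x, ∀ c ∈ K, h x ≤ excess x c := fun x c hc =>
    csInf_le ⟨0, by rintro _ ⟨c, -, rfl⟩; exact excess_nonneg x c⟩ (mem_image_of_mem _ hc)
  have hanti : Antitone h := fun x y hxy => by
    obtain ⟨c, hc, hxc⟩ := hmin x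
    exact (hle y c hc).trans ((antitone_excess c hxy).trans hxc.ge)
  have hnonneg : ∀ x, 0 ≤ h x := fun x => by
    obtain ⟨c, -, hxc⟩ := hmin x
    exact hxc ▸ excess_nonneg x c
  refine ⟨fun n x => Real.exp (-(n * h x)), fun n => by fun_prop, fun n x y hxy => ?_,
    fun n x => ?_, fun x => ?_⟩
  · have := hanti hxy
    dsimp only
    gcongr
  · rw [Real.abs_exp, Real.exp_le_one_iff, neg_nonpos]
    exact mul_nonneg n.cast_nonneg (hnonneg x)
  · by_cases hx : x ∈ (upperClosure K : Set (ι → ℝ≥0∞))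
    · rw [indicator_of_mem hx]
      obtain ⟨c, hc, hcx⟩ := hx
      have : h x = 0 := le_antisymm ((hle x c hc).trans (excess_eq_zero_iff.2 hcx).le) (hnonneg x)
      simp [this]
    · rw [indicator_of_notMem hx]
      have hpos : 0 < h x := (hnonneg x).lt_of_ne fun h0 => hx <| by
        obtain ⟨c, hc, hxc⟩ := hmin x
        exact ⟨c, hc, excess_eq_zero_iff.1 (hxc.symm.trans h0.symm)⟩
      exact Real.tendsto_exp_neg_atTop_nhds_zero.comp
        (tendsto_natCast_atTop_atTop.atTop_mul_const hpos)

end separation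

section refinement

variable {S : Type*} {I : Set (Set S)}

/-- Finitely many members of the ring generated by a semiring and a set whose traces on the ring
lie in the ring are simultaneously resolved by finitely many disjoint members of the semiring. -/
theorem MeasureTheory.IsSetSemiring.exists_resolving_family (hI : IsSetSemiring I)
    {A : Set S} (hA : ∀ E ∈ supClosure I, E ∩ A ∈ supClosure I)
    (s : Finset (Set S)) (hs : ∀ E ∈ s, E ∈ supClosure I) :
    ∃ n : ℕ, 0 < n ∧ ∃ B : Fin n → Set S, (∀ i, B i ∈ I) ∧
      Pairwise (Function.onFun Disjoint B) ∧ (∀ i, B i ⊆ A ∨ Disjoint (B i) A) ∧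
      ∀ E ∈ s, E ⊆ ⋃ i, B i ∧ ∀ i, B i ⊆ E ∨ Disjoint (B i) E := by
  classical
  have hR := hI.isSetRing_supClosure
  let cell : Finset (Set S) × Bool → Set S := fun t =>
    {x | (∀ E ∈ s, x ∈ E ↔ E ∈ t.1) ∧ (x ∈ A ↔ t.2 = true)}
  let T := {t : Finset (Set S) × Bool // t.1 ⊆ s ∧ t.1.Nonempty}
  have : Finite T := by
    refine Set.Finite.to_subtype ((s.powerset ×ˢ Finset.univ).finite_toSet.subset ?_)
    rintro t ht
    simpa using ht.1
  have : Fintype T := Fintype.ofFinite T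
  have hcell : ∀ t : T, cell t.1 ∈ supClosure I := by
    rintro ⟨⟨t, b⟩, ht, E₀, hE₀⟩
    have h₁ : (⋂ E ∈ s, if E ∈ t then E₀ ∩ E else E₀ \ E) ∈ supClosure I :=
      hR.biInter_mem s ⟨E₀, ht hE₀⟩ fun E hE => by
        split_ifs
        exacts [hR.inter_mem (hs _ (ht hE₀)) (hs _ hE), hR.sdiff_mem (hs _ (ht hE₀)) (hs _ hE)]
    have h₂ : ∀ x, (x ∈ ⋂ E ∈ s, if E ∈ t then E₀ ∩ E else E₀ \ E) ↔
        ∀ E ∈ s, x ∈ E ↔ E ∈ t := fun x => by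
      simp only [mem_iInter]
      constructor
      · intro h E hE
        have := h E hE
        split_ifs at this with hEt <;> simp_all
      · intro h E hE
        have hx₀ : x ∈ E₀ := (h E₀ (ht hE₀)).2 hE₀
        have := h E hE
        split_ifs with hEt <;> simp_all
    cases b with
    | true =>
      convert hA _ h₁ using 1
      ext x
      simp only [cell, mem_inter_iff, h₂, mem_ofPred_eq, iff_true]
    | false =>
      convert hR.sdiff_mem h₁ (hA _ h₁) using 1
      ext x
      simp only [cell, mem_inter_iff, Set.mem_sdiff, h₂, mem_ofPred_eq, Bool.false_eq_true,
        iff_false]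
      tauto
  choose Q hQ using fun t => hI.mem_supClosure_iff.1 (hcell t)
  let κ := Option (Σ t : T, (Q t).parts)
  let C : κ → Set S := fun k => k.elim ∅ fun p => p.2.1
  have hCcell : ∀ p : Σ t : T, (Q t).parts, p.2.1 ⊆ cell p.1.1 := fun p => (Q p.1).le p.2.2
  have hdisj : Pairwise (Function.onFun Disjoint C) := by
    rintro (_ | ⟨t, P⟩) (_ | ⟨t', P'⟩) hne
    · exact absurd rfl hne
    · exact disjoint_bot_left
    · exact disjoint_bot_right
    · rcases eq_or_ne t t' with rfl | htt
      · refine (Q t).disjoint P.2 P'.2 fun h => hne ?_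
        rw [Subtype.ext h]
      · refine Set.disjoint_left.2 fun x hx hx' => htt ?_
        have h₁ := hCcell _ hx
        have h₂ := hCcell _ hx'
        refine Subtype.ext (Prod.ext (Finset.ext fun E => ?_) ?_)
        · constructor
          · intro hE
            have := t.2.1 hE
            exact (h₂.1 E this).1 ((h₁.1 E this).2 hE)
          · intro hE
            have := t'.2.1 hE
            exact (h₁.1 E this).1 ((h₂.1 E this).2 hE)
        · exact Bool.eq_iff_iff.2 (h₁.2.symm.trans h₂.2)
  have hCA : ∀ k, C k ⊆ A ∨ Disjoint (C k) A := by
    rintro (_ | p)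
    · exact .inl (empty_subset _)
    · by_cases hb : p.1.1.2 = true
      · exact .inl fun x hx => (hCcell p hx).2.2 hb
      · exact .inr (Set.disjoint_left.2 fun x hx hxA => hb ((hCcell p hx).2.1 hxA))
  have hCs : ∀ E ∈ s, E ⊆ ⋃ k, C k ∧ ∀ k, C k ⊆ E ∨ Disjoint (C k) E := by
    refine fun E hE => ⟨fun x hx => ?_, ?_⟩
    · let t : T := ⟨(s.filter (x ∈ ·), decide (x ∈ A)), Finset.filter_subset _ _,
        E, Finset.mem_filter.2 ⟨hE, hx⟩⟩
      have hxt : x ∈ cell t.1 := ⟨fun F hF => by simp [t, hF], by simp [t]⟩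
      rw [← (Q t).sup_parts, Finset.sup_id_set_eq_sUnion] at hxt
      obtain ⟨P, hP, hxP⟩ := hxt
      exact mem_iUnion.2 ⟨some ⟨t, P, hP⟩, hxP⟩
    · rintro (_ | p)
      · exact .inl (empty_subset _)
      · by_cases hEp : E ∈ p.1.1.1
        · exact .inl fun x hx => ((hCcell p hx).1 E hE).2 hEp
        · exact .inr (Set.disjoint_left.2 fun x hx hxE => hEp (((hCcell p hx).1 E hE).1 hxE))
  let e := (Fintype.equivFin κ).symm
  refine ⟨Fintype.card κ, Fintype.card_pos, C ∘ e, fun i => ?_,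
    hdisj.comp_of_injective e.injective, fun i => hCA _, fun E hE => ⟨?_, fun i => (hCs E hE).2 _⟩⟩
  · generalize hk : e i = k
    simp only [Function.comp, hk]
    rcases k with _ | p
    · exact hI.empty_mem
    · exact hQ p.1 p.2.2
  · exact (hCs E hE).1.trans (e.surjective.iUnion_comp C).ge

end refinement

section covariance

variable {Ω : Type*} [MeasurableSpace Ω] {P : Measure Ω}

/-- Two real random variables are nonpositively correlated. -/
def NonposCorr (P : Measure Ω) (f g : Ω → ℝ) : Prop :=
  ∫ ω, f ω * g ω ∂P ≤ (∫ ω, f ω ∂P) * ∫ ω, g ω ∂P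

theorem NonposCorr.of_tendsto [IsFiniteMeasure P] {κ : Type*} {l : Filter κ}
    [l.IsCountablyGenerated] [l.NeBot] {f g : κ → Ω → ℝ} {f' g' : Ω → ℝ} {C D : ℝ}
    (hf : ∀ k, Measurable (f k)) (hg : ∀ k, Measurable (g k))
    (hfC : ∀ k ω, |f k ω| ≤ C) (hgD : ∀ k ω, |g k ω| ≤ D)
    (hff' : ∀ ω, Tendsto (f · ω) l (𝓝 (f' ω))) (hgg' : ∀ ω, Tendsto (g · ω) l (𝓝 (g' ω)))
    (h : ∀ k, NonposCorr P (f k) (g k)) : NonposCorr P f' g' := by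
  refine le_of_tendsto_of_tendsto'
    (tendsto_integral_filter_of_dominated_convergence (fun _ => C * D)
      (.of_forall fun k => ((hf k).mul (hg k)).aestronglyMeasurable)
      (.of_forall fun k => .of_forall fun ω => ?_) (integrable_const _)
      (.of_forall fun ω => (hff' ω).mul (hgg' ω)))
    ((tendsto_integral_filter_of_dominated_convergence (fun _ => C)
      (.of_forall fun k => (hf k).aestronglyMeasurable)
      (.of_forall fun k => .of_forall fun ω => hfC k ω) (integrable_const _)
      (.of_forall hff')).mul
    (tendsto_integral_filter_of_dominated_convergence (fun _ => D)
      (.of_forall fun k => (hg k).aestronglyMeasurable)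
      (.of_forall fun k => .of_forall fun ω => hgD k ω) (integrable_const _)
      (.of_forall hgg'))) h
  rw [Real.norm_eq_abs, Pi.mul_apply, abs_mul]
  exact mul_le_mul (hfC k ω) (hgD k ω) (abs_nonneg _) ((abs_nonneg _).trans (hfC k ω))

end covariance

section randomMeasure

variable {Ω S : Type*} [MeasurableSpace Ω] [MeasurableSpace S] {P : Measure Ω}
  {M : Ω → Measure S} {I R : Set (Set S)}

theorem measurable_measure_restrict {A : Set S} (hA : MeasurableSet A) :
    Measurable fun μ : Measure S => μ.restrict A :=
  Measure.measurable_of_measurable_coe _ fun s hs => by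
    simpa only [Measure.restrict_apply hs] using Measure.measurable_coe (hs.inter hA)

theorem measure_eq_sum_ite {κ : Type*} [Fintype κ] {C : κ → Set S} (hC : ∀ k, MeasurableSet (C k))
    (hd : Pairwise (Function.onFun Disjoint C)) (p : κ → Prop) [DecidablePred p] {D : Set S}
    (hD : ∀ x, x ∈ D ↔ ∃ k, p k ∧ x ∈ C k) (μ : Measure S) :
    μ D = ∑ k, if p k then μ (C k) else 0 := by
  have : D = ⋃ k ∈ Finset.univ.filter p, C k := by
    ext x
    simp [hD]
  rw [this, measure_biUnion_finset (fun i _ j _ h => hd h) fun k _ => hC k, Finset.sum_filter]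

/-- A vector with the coordinates outside a finite set replaced by `0`. -/
noncomputable def truncate {ι : Type*} (s : Finset ι) (x : ι → ℝ≥0∞) : ι → ℝ≥0∞ :=
  open Classical in fun i => if i ∈ s then x i else 0

theorem monotone_truncate {ι : Type*} (s : Finset ι) : Monotone (truncate s) := fun x y h i => by
  unfold truncate
  split_ifs
  exacts [h i, le_rfl]

theorem tendsto_truncate {ι : Type*} (x : ι → ℝ≥0∞) :
    Tendsto (fun s => truncate s x) atTop (𝓝 x) := by
  refine tendsto_pi_nhds.2 fun i => tendsto_const_nhds.congr' ?_
  filter_upwards [eventually_ge_atTop {i}] with s hs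
  exact (if_pos (hs (Finset.mem_singleton_self i))).symm

theorem measurable_truncate {ι : Type*} (s : Finset ι) : Measurable (truncate s) :=
  measurable_pi_lambda _ fun i => by
    unfold truncate
    split_ifs
    exacts [measurable_pi_apply i, measurable_const]

/-- A random measure has negatively associated values on the members of `I`. -/
def NegAssocOn (P : Measure Ω) (M : Ω → Measure S) (I : Set (Set S)) : Prop :=
  ∀ n : ℕ, 0 < n → ∀ B : Fin n → Set S, (∀ i, B i ∈ I) → Pairwise (Function.onFun Disjoint B) →
    NegAssoc P (fun i ω => M ω (B i))

theorem NegAssocOn.nonposCorr_truncate (hM : NegAssocOn P M I) (hI : IsSetSemiring I)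
    (hR : IsGeneratingRing (supClosure I)) {A : Set S} (hA : A ∈ traceAlgebra (supClosure I))
    {φ ψ : (supClosure I → ℝ≥0∞) → ℝ} (hφ : Measurable φ) (hφm : Monotone φ)
    (hφb : ∃ C, ∀ x, |φ x| ≤ C) (hψ : Measurable ψ) (hψm : Monotone ψ)
    (hψb : ∃ C, ∀ x, |ψ x| ≤ C) (s : Finset (supClosure I)) :
    NonposCorr P (fun ω => φ (truncate s (valuesOn _ ((M ω).restrict A))))
      (fun ω => ψ (truncate s (valuesOn _ ((M ω).restrict Aᶜ)))) := by
  classical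
  obtain ⟨n, hn, B, hBI, hBd, hBA, hBs⟩ := hI.exists_resolving_family hA.2
    (s.map (Function.Embedding.subtype _)) (by simp +contextual)
  have hBm : ∀ i, MeasurableSet (B i) := fun i => hR.measurableSet (subset_supClosure (hBI i))
  let J : Set (Fin n) := {i | B i ⊆ A}
  let vec : (K : Set (Fin n)) → (K → ℝ≥0∞) → supClosure I → ℝ≥0∞ := fun K x =>
    truncate s fun E => ∑ i, if B i.1 ⊆ E.1 then x i else 0
  have hvm : ∀ K, Monotone (vec K) := fun K x y hxy => monotone_truncate s fun E =>
    Finset.sum_le_sum fun i _ => by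
      split_ifs
      exacts [hxy i, le_rfl]
  have hvmeas : ∀ K, Measurable (vec K) := fun K =>
    (measurable_truncate s).comp <| measurable_pi_lambda _ fun E =>
      Finset.measurable_sum _ fun i _ => by
        split_ifs
        exacts [measurable_pi_apply i, measurable_const]
  have hvec : ∀ (K : Set (Fin n)) (D : Set S), (∀ i ∈ K, B i ⊆ D) → (∀ i ∉ K, Disjoint (B i) D) →
      ∀ μ : Measure S, vec K (fun i => μ (B i.1)) = truncate s (valuesOn _ (μ.restrict D)) := by
    intro K D hK hK' μ
    funext E
    simp only [vec, truncate, valuesOn]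
    split_ifs with hE
    · rw [Measure.restrict_apply (hR.measurableSet E.2)]
      have hE' := hBs E.1 (by simpa using hE)
      refine (measure_eq_sum_ite (fun i : K => hBm i) (fun i j hij => hBd fun h => hij
        (Subtype.ext h)) (fun i => B i.1 ⊆ E.1) (fun x => ⟨fun hx => ?_, ?_⟩) μ).symm
      · obtain ⟨i, hi⟩ := mem_iUnion.1 (hE'.1 hx.1)
        have hiK : i ∈ K := by
          by_contra h
          exact Set.disjoint_left.1 (hK' i h) hi hx.2
        exact ⟨⟨i, hiK⟩, (hE'.2 i).resolve_right fun h => Set.disjoint_left.1 h hi hx.1, hi⟩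
      · rintro ⟨i, hi, hx⟩
        exact ⟨hi hx, hK i.1 i.2 hx⟩
    · rfl
  have key := hM n hn B hBI hBd J (fun x => φ (vec J x)) (fun x => ψ (vec Jᶜ x))
    (hφ.comp (hvmeas J)) (hφm.comp (hvm J)) (hφb.imp fun C h x => h _)
    (hψ.comp (hvmeas _)) (hψm.comp (hvm _)) (hψb.imp fun C h x => h _)
  have h₁ := hvec J A (fun i hi => hi) fun i hi => (hBA i).resolve_left hi
  have h₂ := hvec Jᶜ Aᶜ (fun i hi => ((hBA i).resolve_left hi).subset_compl_right)
    fun i hi => disjoint_compl_right_iff_subset.2 (not_not.1 hi)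
  simp only [h₁, h₂] at key
  exact key

theorem NegAssocOn.nonposCorr_continuous [IsProbabilityMeasure P] (hM : NegAssocOn P M I)
    (hMm : Measurable M)
    (hI : IsSetSemiring I) (hR : IsGeneratingRing (supClosure I))
    (hfin : ∀ ω, FiniteOn (supClosure I) (M ω))
    {A : Set S} (hA : MeasurableSet A)
    {φ ψ : (supClosure I → ℝ≥0∞) → ℝ} (hφ : Continuous φ) (hφm : Monotone φ) {C : ℝ}
    (hφb : ∀ x, |φ x| ≤ C) (hψ : Continuous ψ) (hψm : Monotone ψ) {D : ℝ}
    (hψb : ∀ x, |ψ x| ≤ D) :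
    NonposCorr P (fun ω => φ (valuesOn _ ((M ω).restrict A)))
      (fun ω => ψ (valuesOn _ ((M ω).restrict Aᶜ))) := by
  have : Countable (supClosure I) := hR.countable.to_subtype
  have hmeas : ∀ {A : Set S}, MeasurableSet A →
      Measurable fun ω => valuesOn (supClosure I) ((M ω).restrict A) := fun {A} hA =>
    (measurable_valuesOn hR).comp ((measurable_measure_restrict hA).comp hMm)
  have htend : ∀ (f : ℕ → Set S) (A : Set S), (∀ E ∈ supClosure I, ∀ ω,
      Tendsto (fun n => M ω (E ∩ f n)) atTop (𝓝 (M ω (E ∩ A)))) → ∀ ω,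
      Tendsto (fun n => valuesOn (supClosure I) ((M ω).restrict (f n))) atTop
        (𝓝 (valuesOn _ ((M ω).restrict A))) := by
    intro f A h ω
    refine tendsto_pi_nhds.2 fun E => ?_
    simp only [valuesOn, Measure.restrict_apply (hR.measurableSet E.2)]
    exact h E.1 E.2 ω
  have hinc : ∀ f : ℕ → Set S, Monotone f → ∀ E ∈ supClosure I, ∀ ω,
      Tendsto (fun n => M ω (E ∩ f n)) atTop (𝓝 (M ω (E ∩ ⋃ n, f n))) :=
    fun f hf E hE ω => tendsto_measure_inter_iUnion hf
  have hdec : ∀ f : ℕ → Set S, Antitone f → (∀ n, MeasurableSet (f n)) → ∀ E ∈ supClosure I, ∀ ω,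
      Tendsto (fun n => M ω (E ∩ f n)) atTop (𝓝 (M ω (E ∩ ⋂ n, f n))) :=
    fun f hf hfm E hE ω => tendsto_measure_inter_iInter (hfin ω E hE) (hR.measurableSet hE) hfm hf
  have hlim : ∀ (f : ℕ → Set S) (A : Set S), (∀ n, MeasurableSet (f n)) →
      (∀ E ∈ supClosure I, ∀ ω, Tendsto (fun n => M ω (E ∩ f n)) atTop (𝓝 (M ω (E ∩ A)))) →
      (∀ E ∈ supClosure I, ∀ ω, Tendsto (fun n => M ω (E ∩ (f n)ᶜ)) atTop (𝓝 (M ω (E ∩ Aᶜ)))) →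
      (∀ n, NonposCorr P (fun ω => φ (valuesOn _ ((M ω).restrict (f n))))
        (fun ω => ψ (valuesOn _ ((M ω).restrict (f n)ᶜ)))) →
      NonposCorr P (fun ω => φ (valuesOn _ ((M ω).restrict A)))
        (fun ω => ψ (valuesOn _ ((M ω).restrict Aᶜ))) := by
    intro f A hfm h₁ h₂ h
    exact NonposCorr.of_tendsto (fun n => hφ.measurable.comp (hmeas (hfm n)))
      (fun n => hψ.measurable.comp (hmeas (hfm n).compl)) (fun n ω => hφb _) (fun n ω => hψb _)
      (fun ω => (hφ.tendsto _).comp (htend f A h₁ ω))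
      (fun ω => (hψ.tendsto _).comp (htend (fun n => (f n)ᶜ) Aᶜ h₂ ω)) h
  refine hR.monotone_class_induction (p := fun A =>
    NonposCorr P (fun ω => φ (valuesOn _ ((M ω).restrict A)))
      (fun ω => ψ (valuesOn _ ((M ω).restrict Aᶜ)))) (fun A hA => ?_) (fun f hf hfm ih => ?_)
    (fun f hf hfm ih => ?_) hA
  · exact NonposCorr.of_tendsto
      (fun s => (hφ.measurable.comp (measurable_truncate s)).comp (hmeas hA.1))
      (fun s => (hψ.measurable.comp (measurable_truncate s)).comp (hmeas hA.1.compl))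
      (fun s ω => hφb _) (fun s ω => hψb _)
      (fun ω => (hφ.tendsto _).comp (tendsto_truncate _))
      (fun ω => (hψ.tendsto _).comp (tendsto_truncate _))
      fun s => hM.nonposCorr_truncate hI hR hA hφ.measurable hφm ⟨C, hφb⟩ hψ.measurable hψm
        ⟨D, hψb⟩ s
  · refine hlim f _ hfm (hinc f hf) ?_ ih
    rw [compl_iUnion]
    exact hdec _ (fun i j h => compl_subset_compl.2 (hf h)) fun n => (hfm n).compl
  · refine hlim f _ hfm (hdec f hf hfm) ?_ ih
    rw [compl_iInter]
    exact hinc _ fun i j h => compl_subset_compl.2 (hf h)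

end randomMeasure

section superlevel

variable {Ω : Type*} [MeasurableSpace Ω] {P : Measure Ω}

theorem NonposCorr.symm {f g : Ω → ℝ} (h : NonposCorr P f g) : NonposCorr P g f := by
  simpa only [NonposCorr, mul_comm] using h

theorem NonposCorr.sum_smul_add_const [IsProbabilityMeasure P] {κ : Type*} {s : Finset κ}
    {f : κ → Ω → ℝ} {g : Ω → ℝ} {b c : ℝ} (hc : 0 ≤ c) (hf : ∀ i ∈ s, Integrable (f i) P)
    (hg : Integrable g P) (hfg : ∀ i ∈ s, Integrable (fun ω => f i ω * g ω) P)
    (h : ∀ i ∈ s, NonposCorr P (f i) g) :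
    NonposCorr P (fun ω => c * ∑ i ∈ s, f i ω + b) g := by
  have h₁ : ∫ ω, (c * ∑ i ∈ s, f i ω + b) * g ω ∂P
      = c * ∑ i ∈ s, ∫ ω, f i ω * g ω ∂P + b * ∫ ω, g ω ∂P := by
    simp only [add_mul, mul_assoc, Finset.sum_mul]
    rw [integral_add ((integrable_finsetSum _ hfg).const_mul c) (hg.const_mul b),
      integral_const_mul, integral_const_mul, integral_finsetSum _ hfg]
  have h₂ : ∫ ω, (c * ∑ i ∈ s, f i ω + b) ∂P = c * ∑ i ∈ s, ∫ ω, f i ω ∂P + b := by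
    rw [integral_add ((integrable_finsetSum _ hf).const_mul c) (integrable_const b),
      integral_const_mul, integral_finsetSum _ hf]
    simp
  unfold NonposCorr
  rw [h₁, h₂, add_mul, mul_assoc, Finset.sum_mul]
  gcongr with i hi
  exact h i hi

theorem NonposCorr.of_superlevel [IsProbabilityMeasure P] {f g : Ω → ℝ} {C D : ℝ}
    (hf : Measurable f) (hg : Measurable g) (hfC : ∀ ω, |f ω| ≤ C) (hgD : ∀ ω, |g ω| ≤ D)
    (h : ∀ t, NonposCorr P ({ω | t ≤ f ω}.indicator 1) g) : NonposCorr P f g := by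
  let a : ℕ → ℕ → Ω → ℝ := fun n k => {ω | ((k + 1 : ℕ) : ℝ) / (n + 1 : ℕ) - C ≤ f ω}.indicator 1
  have ham : ∀ n k, Measurable (a n k) := fun n k =>
    measurable_one.indicator (measurableSet_le measurable_const hf)
  have hab : ∀ n k ω, |a n k ω| ≤ 1 := fun n k ω => by
    simp only [a, indicator]
    split_ifs <;> simp
  have hgi : Integrable g P := .of_bound hg.aestronglyMeasurable D (.of_forall hgD)
  have hai : ∀ n k, Integrable (a n k) P := fun n k =>
    .of_bound (ham n k).aestronglyMeasurable 1 (.of_forall (hab n k))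
  let N : ℕ → ℕ := fun n => ⌊(2 * C) * (n + 1 : ℕ)⌋₊
  have hfloor : ∀ n ω, ∑ k ∈ Finset.range (N n), a n k ω = ⌊(f ω + C) * (n + 1 : ℕ)⌋₊ := by
    intro n ω
    have h₀ : ∀ k, a n k ω = if k < ⌊(f ω + C) * (n + 1 : ℕ)⌋₊ then 1 else 0 := fun k => by
      simp only [a, indicator, mem_ofPred_eq, Pi.one_apply]
      congr 1
      rw [← Nat.succ_le_iff, Nat.le_floor_iff' k.succ_ne_zero, sub_le_iff_le_add,
        div_le_iff₀ (by positivity)]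
    have h₁ : ⌊(f ω + C) * (n + 1 : ℕ)⌋₊ ≤ N n := by
      refine Nat.floor_le_floor ?_
      have := (abs_le.1 (hfC ω)).2
      gcongr
      linarith
    simp only [h₀, Finset.sum_boole]
    congr 1
    rw [show (Finset.range (N n)).filter (· < ⌊(f ω + C) * (n + 1 : ℕ)⌋₊)
      = Finset.range ⌊(f ω + C) * (n + 1 : ℕ)⌋₊ by
        ext k
        simp only [Finset.mem_filter, Finset.mem_range]
        omega, Finset.card_range]
  have hpos : ∀ ω, 0 ≤ f ω + C := fun ω => by linarith [(abs_le.1 (hfC ω)).1]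
  refine NonposCorr.of_tendsto (l := atTop) (C := 3 * C) (D := D)
    (f := fun n ω => ((n + 1 : ℕ) : ℝ)⁻¹ * ∑ k ∈ Finset.range (N n), a n k ω + -C)
    (g := fun _ => g)
    (fun n => ((Finset.measurable_sum _ fun k _ => ham n k).const_mul _).add_const _) (fun _ => hg)
    (fun n ω => ?_) (fun _ => hgD) (fun ω => ?_) (fun ω => tendsto_const_nhds) fun n => ?_
  · rw [hfloor]
    have h₁ := Nat.floor_le (mul_nonneg (hpos ω) (n + 1).cast_nonneg)
    have h₂ : ((n + 1 : ℕ) : ℝ)⁻¹ * ⌊(f ω + C) * (n + 1 : ℕ)⌋₊ ≤ f ω + C := by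
      rwa [inv_mul_le_iff₀ (by positivity), mul_comm (_ : ℝ) (f ω + C)]
    have h₃ : 0 ≤ ((n + 1 : ℕ) : ℝ)⁻¹ * ⌊(f ω + C) * (n + 1 : ℕ)⌋₊ := by positivity
    have := abs_le.1 (hfC ω)
    exact abs_le.2 ⟨by linarith, by linarith⟩
  · simp only [hfloor]
    have := ((tendsto_nat_floor_mul_div_atTop (hpos ω)).comp
      (tendsto_natCast_atTop_atTop.comp (tendsto_add_atTop_nat 1))).add_const (-C)
    simpa [Function.comp_def, div_eq_inv_mul] using this
  · exact NonposCorr.sum_smul_add_const (by positivity) (fun k _ => hai n k) hgi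
      (fun k _ => hgi.bdd_mul (ham n k).aestronglyMeasurable (.of_forall (hab n k)))
      fun k _ => h _

theorem nonposCorr_indicator_iff [IsFiniteMeasure P] {a b : Set Ω} (ha : MeasurableSet a)
    (hb : MeasurableSet b) :
    NonposCorr P (a.indicator 1) (b.indicator 1) ↔ P.real (a ∩ b) ≤ P.real a * P.real b := by
  unfold NonposCorr
  have : ∀ ω, a.indicator (1 : Ω → ℝ) ω * b.indicator 1 ω = (a ∩ b).indicator 1 ω := fun ω => by
    rw [inter_indicator_one]
    rfl
  simp only [this]
  rw [integral_indicator_one ha, integral_indicator_one hb, integral_indicator_one (ha.inter hb)]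

end superlevel

section upperSets

variable {Ω S : Type*} [MeasurableSpace Ω] [MeasurableSpace S] {P : Measure Ω}
  {M : Ω → Measure S} {I R : Set (Set S)}

/-- A set of measures is an upper set relative to the values on `R`, among the measures which are
finite on `R`. -/
def IsUpperOn (R : Set (Set S)) (U : Set (Measure S)) : Prop :=
  ∀ μ ν, FiniteOn R μ → FiniteOn R ν → valuesOn R μ ≤ valuesOn R ν → μ ∈ U → ν ∈ U

theorem FiniteOn.restrict {μ : Measure S} (hμ : FiniteOn R μ) (A : Set S) :
    FiniteOn R (μ.restrict A) := fun E hE =>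
  ne_top_of_le_ne_top (hμ E hE) (Measure.restrict_apply_le A E)

/-- Upper sets of measures are approximated from inside by upper closures of compact sets of
finitely additive functions. -/
theorem IsUpperOn.exists_isClosed_inner_approx [IsFiniteMeasure P] (hR : IsGeneratingRing R)
    {N : Ω → Measure S} (hN : Measurable N) (hfin : ∀ ω, FiniteOn R (N ω))
    {U : Set (Measure S)} (hU : MeasurableSet U) (hUup : IsUpperOn R U) {ε : ℝ≥0∞} (hε : ε ≠ 0) :
    ∃ K : Set (R → ℝ≥0∞), IsClosed K ∧
      (∀ ν, FiniteOn R ν → valuesOn R ν ∈ upperClosure K → ν ∈ U) ∧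
      P {ω | N ω ∈ U ∧ valuesOn R (N ω) ∉ K} < ε := by
  have : Countable R := hR.countable.to_subtype
  obtain ⟨V, hV, hUV⟩ := exists_measurableSet_valuesOn hR hU
  have hVN : Measurable fun ω => valuesOn R (N ω) := (measurable_valuesOn hR).comp hN
  have hVa := hV.inter (isClosed_additiveOn R).measurableSet
  obtain ⟨K, hKV, hK, hKε⟩ := hVa.exists_isClosed_sdiff_lt
    (μ := P.map fun ω => valuesOn R (N ω)) (measure_ne_top _ _) hε
  refine ⟨K, hK, fun ν hν hνK => ?_, ?_⟩
  · obtain ⟨x, hx, hxν⟩ := mem_upperClosure.1 hνK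
    obtain ⟨μ, hμ, rfl⟩ := exists_measure_of_additiveOn hR hν (hKV hx).2 hxν
    exact hUup μ ν hμ hν hxν ((hUV μ hμ).2 (hKV hx).1)
  · rw [Measure.map_apply hVN (hVa.diff hK.measurableSet)] at hKε
    refine (measure_mono fun ω hω => ?_).trans_lt hKε
    exact ⟨⟨(hUV _ (hfin ω)).1 hω.1, valuesOn_mem_additiveOn hR _⟩, hω.2⟩

theorem NegAssocOn.nonposCorr_upperClosure [IsProbabilityMeasure P] (hM : NegAssocOn P M I)
    (hMm : Measurable M) (hI : IsSetSemiring I) (hR : IsGeneratingRing (supClosure I))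
    (hfin : ∀ ω, FiniteOn (supClosure I) (M ω)) {A : Set S} (hA : MeasurableSet A)
    {K L : Set (supClosure I → ℝ≥0∞)} (hK : IsClosed K) (hL : IsClosed L) :
    NonposCorr P ({ω | valuesOn _ ((M ω).restrict A) ∈ upperClosure K}.indicator 1)
      ({ω | valuesOn _ ((M ω).restrict Aᶜ) ∈ upperClosure L}.indicator 1) := by
  have : Countable (supClosure I) := hR.countable.to_subtype
  have := Encodable.ofCountable (supClosure I)
  obtain ⟨φ, hφ, hφm, hφb, hφK⟩ := exists_continuous_monotone_tendsto_indicator hK.isCompact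
  obtain ⟨ψ, hψ, hψm, hψb, hψL⟩ := exists_continuous_monotone_tendsto_indicator hL.isCompact
  have hmeas : ∀ {A : Set S}, MeasurableSet A →
      Measurable fun ω => valuesOn (supClosure I) ((M ω).restrict A) := fun {A} hA =>
    (measurable_valuesOn hR).comp ((measurable_measure_restrict hA).comp hMm)
  exact NonposCorr.of_tendsto (fun n => (hφ n).measurable.comp (hmeas hA))
    (fun n => (hψ n).measurable.comp (hmeas hA.compl)) (fun n ω => hφb n _) (fun n ω => hψb n _)
    (fun ω => hφK _) (fun ω => hψL _)
    fun n => hM.nonposCorr_continuous hMm hI hR hfin hA (hφ n) (hφm n) (hφb n) (hψ n) (hψm n)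
      (hψb n)

theorem measurableSet_upperClosure {ι : Type*} [Countable ι] {K : Set (ι → ℝ≥0∞)}
    (hK : IsClosed K) : MeasurableSet (upperClosure K : Set (ι → ℝ≥0∞)) := by
  have := Encodable.ofCountable ι
  obtain ⟨φ, hφ, -, -, hφK⟩ := exists_continuous_monotone_tendsto_indicator hK.isCompact
  exact (measurable_indicator_const_iff (1 : ℝ)).1
    (measurable_of_tendsto_metrizable (fun n => (hφ n).measurable) (tendsto_pi_nhds.2 hφK))

theorem NegAssocOn.nonposCorr_indicator [IsProbabilityMeasure P] (hM : NegAssocOn P M I)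
    (hMm : Measurable M) (hI : IsSetSemiring I) (hR : IsGeneratingRing (supClosure I))
    (hfin : ∀ ω, FiniteOn (supClosure I) (M ω)) {A : Set S} (hA : MeasurableSet A)
    {U V : Set (Measure S)} (hU : MeasurableSet U) (hUup : IsUpperOn (supClosure I) U)
    (hV : MeasurableSet V) (hVup : IsUpperOn (supClosure I) V) :
    NonposCorr P ({ω | (M ω).restrict A ∈ U}.indicator 1)
      ({ω | (M ω).restrict Aᶜ ∈ V}.indicator 1) := by
  have : Countable (supClosure I) := hR.countable.to_subtype
  have hmeas : ∀ {A : Set S}, MeasurableSet A → Measurable fun ω => (M ω).restrict A :=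
    fun {A} hA => (measurable_measure_restrict hA).comp hMm
  refine (nonposCorr_indicator_iff (hmeas hA hU) (hmeas hA.compl hV)).2 ?_
  refine le_of_forall_pos_le_add fun ε hε => ?_
  have hε' : ENNReal.ofReal (ε / 2) ≠ 0 := (ENNReal.ofReal_pos.2 (half_pos hε)).ne'
  obtain ⟨K, hK, hKU, hKε⟩ := hUup.exists_isClosed_inner_approx (P := P) hR (hmeas hA)
    (fun ω => (hfin ω).restrict A) hU hε'
  obtain ⟨L, hL, hLV, hLε⟩ := hVup.exists_isClosed_inner_approx (P := P) hR (hmeas hA.compl)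
    (fun ω => (hfin ω).restrict Aᶜ) hV hε'
  have key := hM.nonposCorr_upperClosure hMm hI hR hfin hA hK hL
  replace key := (nonposCorr_indicator_iff
    ((measurable_valuesOn hR).comp (hmeas hA) (measurableSet_upperClosure hK))
    ((measurable_valuesOn hR).comp (hmeas hA.compl) (measurableSet_upperClosure hL))).1 key
  have hreal : ∀ {s : Set Ω}, P s < ENNReal.ofReal (ε / 2) → P.real s ≤ ε / 2 := fun h =>
    ENNReal.toReal_le_of_le_ofReal (half_pos hε).le h.le
  calc P.real ({ω | (M ω).restrict A ∈ U} ∩ {ω | (M ω).restrict Aᶜ ∈ V})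
      ≤ P.real (({ω | valuesOn _ ((M ω).restrict A) ∈ upperClosure K} ∩
          {ω | valuesOn _ ((M ω).restrict Aᶜ) ∈ upperClosure L}) ∪
        ({ω | (M ω).restrict A ∈ U ∧ valuesOn _ ((M ω).restrict A) ∉ K} ∪
          {ω | (M ω).restrict Aᶜ ∈ V ∧ valuesOn _ ((M ω).restrict Aᶜ) ∉ L})) := by
        refine measureReal_mono fun ω hω => ?_
        by_cases h₁ : valuesOn _ ((M ω).restrict A) ∈ K
        · by_cases h₂ : valuesOn _ ((M ω).restrict Aᶜ) ∈ L
          · exact .inl ⟨subset_upperClosure h₁, subset_upperClosure h₂⟩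
          · exact .inr (.inr ⟨hω.2, h₂⟩)
        · exact .inr (.inl ⟨hω.1, h₁⟩)
    _ ≤ P.real {ω | valuesOn _ ((M ω).restrict A) ∈ upperClosure K} *
          P.real {ω | valuesOn _ ((M ω).restrict Aᶜ) ∈ upperClosure L} + (ε / 2 + ε / 2) :=
        (measureReal_union_le _ _).trans <| add_le_add key <|
          (measureReal_union_le _ _).trans <| add_le_add (hreal hKε) (hreal hLε)
    _ ≤ _ := by
        rw [add_halves]
        exact add_le_add_left (mul_le_mul
          (measureReal_mono fun ω : Ω => hKU _ ((hfin ω).restrict A))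
          (measureReal_mono fun ω : Ω => hLV _ ((hfin ω).restrict Aᶜ))
          measureReal_nonneg measureReal_nonneg) ε

/-- Negative association of the values on a semiring is inherited by monotone functions of the
restrictions to a set and to its complement. -/
theorem NegAssocOn.nonposCorr [IsProbabilityMeasure P] (hM : NegAssocOn P M I)
    (hMm : Measurable M) (hI : IsSetSemiring I) (hR : IsGeneratingRing (supClosure I))
    (hfin : ∀ ω, FiniteOn (supClosure I) (M ω)) {A : Set S} (hA : MeasurableSet A)
    {F G : Measure S → ℝ} {C D : ℝ} (hF : Measurable F) (hFC : ∀ μ, |F μ| ≤ C)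
    (hFup : ∀ t, IsUpperOn (supClosure I) {μ | t ≤ F μ})
    (hG : Measurable G) (hGD : ∀ μ, |G μ| ≤ D)
    (hGup : ∀ t, IsUpperOn (supClosure I) {μ | t ≤ G μ}) :
    NonposCorr P (fun ω => F ((M ω).restrict A)) (fun ω => G ((M ω).restrict Aᶜ)) := by
  have hFm := hF.comp ((measurable_measure_restrict hA).comp hMm)
  have hGm := hG.comp ((measurable_measure_restrict hA.compl).comp hMm)
  refine NonposCorr.of_superlevel (C := C) (D := D) hFm hGm (fun ω => hFC _) (fun ω => hGD _)
    fun t => .symm ?_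
  refine NonposCorr.of_superlevel (C := D) (D := 1) hGm
    (measurable_one.indicator (measurableSet_le measurable_const hFm)) (fun ω => hGD _)
    (fun ω => ?_) fun u => .symm ?_
  · simp only [indicator]
    split_ifs <;> simp
  · exact hM.nonposCorr_indicator hMm hI hR hfin hA (measurableSet_le measurable_const hF) (hFup t)
      (measurableSet_le measurable_const hG) (hGup u)

end upperSets

namespace IsDissectingSemiring

variable {S : Type*} [MeasurableSpace S] [MetricSpace S] {I : Set (Set S)}

theorem isSetSemiring (hI : IsDissectingSemiring I) : IsSetSemiring I where
  empty_mem := hI.empty_mem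
  inter_mem := hI.inter_mem
  sdiff_eq_sUnion' := hI.diff_eq_disjoint_sUnion

theorem mem_supClosure_iff (hI : IsDissectingSemiring I) {E : Set S} :
    E ∈ supClosure I ↔ ∃ F : Finset (Set S), ↑F ⊆ I ∧ E = ⋃₀ ↑F := by
  constructor
  · intro hE
    obtain ⟨Q, hQ⟩ := hI.isSetSemiring.mem_supClosure_iff.1 hE
    exact ⟨Q.parts, hQ, by rw [← Finset.sup_id_set_eq_sUnion, Q.sup_parts]⟩
  · rintro ⟨F, hF, rfl⟩
    rw [← Finset.sup_id_set_eq_sUnion]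
    exact hI.isSetSemiring.isSetRing_supClosure.finsetSup_mem fun E hE =>
      subset_supClosure (hF hE)

theorem isBounded_of_mem_supClosure (hI : IsDissectingSemiring I) {E : Set S}
    (hE : E ∈ supClosure I) : Bornology.IsBounded E := by
  obtain ⟨F, hF, rfl⟩ := hI.mem_supClosure_iff.1 hE
  exact (Bornology.isBounded_sUnion F.finite_toSet).2 fun B hB => hI.isBounded B (hF hB)

theorem isGeneratingRing (hI : IsDissectingSemiring I) : IsGeneratingRing (supClosure I) where
  isSetRing := hI.isSetSemiring.isSetRing_supClosure
  countable := by
    refine ((countable_ofPred_finite_subset hI.countable).image sUnion).mono fun E hE => ?_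
    obtain ⟨F, hF, rfl⟩ := hI.mem_supClosure_iff.1 hE
    exact ⟨F, ⟨F.finite_toSet, hF⟩, rfl⟩
  generateFrom_eq := by
    refine le_antisymm ?_ (MeasurableSpace.generateFrom_le fun E hE => ?_)
    · exact hI.generateFrom_eq.ge.trans (MeasurableSpace.generateFrom_mono subset_supClosure)
    · obtain ⟨F, hF, rfl⟩ := hI.mem_supClosure_iff.1 hE
      exact MeasurableSet.sUnion F.countable_toSet fun B hB => hI.measurableSet B (hF hB)
  exists_cover := by
    rcases isEmpty_or_nonempty S with _ | ⟨⟨x⟩⟩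
    · exact ⟨fun _ => ∅, fun _ => subset_supClosure hI.empty_mem, Subsingleton.elim _ _⟩
    · choose F hF hFB using fun n : ℕ =>
        hI.isBounded_covered _ (Metric.isBounded_ball (x := x) (r := n))
      refine ⟨fun n => ⋃₀ ↑(F n), fun n => hI.mem_supClosure_iff.2 ⟨F n, hF n, rfl⟩, ?_⟩
      refine univ_subset_iff.1 ?_
      rw [← Metric.iUnion_ball_nat x]
      exact iUnion_mono hFB

theorem measLE_of_valuesOn_le (hI : IsDissectingSemiring I) {μ ν : Measure S}
    (hμ : FiniteOn (supClosure I) μ) (hν : FiniteOn (supClosure I) ν)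
    (h : valuesOn (supClosure I) μ ≤ valuesOn (supClosure I) ν) : MeasLE μ ν := by
  intro B hB hBb
  obtain ⟨F, hF, hBF⟩ := hI.isBounded_covered B hBb
  have := measure_inter_le_of_valuesOn_le hI.isGeneratingRing hμ hν h hB
    (hI.mem_supClosure_iff.2 ⟨F, hF, rfl⟩)
  rwa [inter_eq_self_of_subset_right hBF] at this

theorem isUpperOn_of_measMono (hI : IsDissectingSemiring I) {F : Measure S → ℝ} (hF : MeasMono F)
    (t : ℝ) : IsUpperOn (supClosure I) {μ | t ≤ F μ} := fun μ ν hμ hν h hμt =>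
  hμt.trans (hF μ ν (hI.measLE_of_valuesOn_le hμ hν h))

end IsDissectingSemiring

section equivalence

variable {Ω S : Type*} [MeasurableSpace Ω] [MeasurableSpace S] [MetricSpace S]
  {P : Measure Ω} {M : Ω → Measure S} {I : Set (Set S)}

theorem RMNegAssoc.negAssoc (hM : RMNegAssoc P M) {ι : Type*} [Countable ι] {B : ι → Set S}
    (hB : ∀ i, MeasurableSet (B i)) (hBb : ∀ i, Bornology.IsBounded (B i))
    (hBd : Pairwise (Function.onFun Disjoint B)) : NegAssoc P (fun i ω => M ω (B i)) := by
  intro J f g hf hfm ⟨C, hC⟩ hg hgm ⟨D, hD⟩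
  have hm : ∀ K : Set ι, MeasurableSet (⋃ i ∈ K, B i) := fun K =>
    .biUnion K.to_countable fun i _ => hB i
  have hmeas : ∀ K : Set ι, Measurable fun (μ : Measure S) (i : K) => μ (B i) := fun K =>
    measurable_pi_lambda _ fun i => Measure.measurable_coe (hB i)
  have hmono : ∀ (K : Set ι) (μ ν : Measure S), MeasLE μ ν →
      (fun i : K => μ (B i)) ≤ fun i : K => ν (B i) := fun K μ ν h i => h _ (hB i) (hBb i)
  have hwrt : ∀ (K : Set ι) (μ : Measure S),
      (fun i : K => μ.restrict (⋃ i ∈ K, B i) (B i)) = fun i : K => μ (B i) := fun K μ =>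
    funext fun i => Measure.restrict_eq_self _ (subset_biUnion_of_mem (u := B) i.2)
  exact hM (⋃ i ∈ J, B i) (⋃ i ∈ Jᶜ, B i) (hm _) (hm _)
    (by
      simp only [disjoint_iUnion_left, disjoint_iUnion_right]
      exact fun j hj i hi => hBd fun h => hj (h ▸ hi))
    (fun μ => f fun i => μ (B i)) (fun μ => g fun i => μ (B i))
    (hf.comp (hmeas J)) (fun μ ν h => hfm (hmono J μ ν h)) ⟨C, fun μ => hC _⟩
    (fun μ => by simp only [hwrt])
    (hg.comp (hmeas _)) (fun μ ν h => hgm (hmono _ μ ν h)) ⟨D, fun μ => hD _⟩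
    (fun μ => by simp only [hwrt])

theorem NegAssocOn.rmNegAssoc [IsProbabilityMeasure P] (hM : NegAssocOn P M I)
    (hMm : Measurable M) (hI : IsDissectingSemiring I)
    (hfin : ∀ ω, FiniteOn (supClosure I) (M ω)) : RMNegAssoc P M := by
  intro A B hA hB hAB F G hF hFm ⟨C, hC⟩ hFA hG hGm ⟨D, hD⟩ hGB
  have hG' : ∀ μ : Measure S, G (μ.restrict Aᶜ) = G μ := fun μ => by
    rw [hGB, Measure.restrict_restrict hB, inter_eq_self_of_subset_left hAB.subset_compl_left,
      ← hGB]
  have := hM.nonposCorr hMm hI.isSetSemiring hI.isGeneratingRing hfin hA hF hC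
    (hI.isUpperOn_of_measMono hFm) hG hD (hI.isUpperOn_of_measMono hGm)
  simpa only [NonposCorr, ← hFA _, hG'] using this

end equivalence

/-- A random measure `M` on a Polish space `S` is negatively associated if and only if,
for every `n ≥ 1` and all pairwise disjoint sets `B 1, …, B n` from a countable
topological dissecting semi-ring `I` of bounded Borel sets generating the Borel σ-field,
the random vector `(M (B 1), …, M (B n))` is negatively associated. -/
theorem rmNegAssoc_iff_finite_dimensional
    {Ω S : Type*} [MeasurableSpace Ω]
    [MetricSpace S] [CompleteSpace S] [SecondCountableTopology S]
    [MeasurableSpace S] [BorelSpace S]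
    (P : Measure Ω) [IsProbabilityMeasure P]
    (M : Ω → Measure S) (hMmeas : Measurable M)
    (hRadon : ∀ ω, ∀ B : Set S, Bornology.IsBounded B → M ω B < ⊤)
    (I : Set (Set S)) (hI : IsDissectingSemiring I) :
    RMNegAssoc P M ↔
      ∀ (n : ℕ), 0 < n → ∀ B : Fin n → Set S, (∀ i, B i ∈ I) →
        Pairwise (Function.onFun Disjoint B) →
        NegAssoc P (fun i ω => M ω (B i)) := by
  have hfin : ∀ ω, FiniteOn (supClosure I) (M ω) := fun ω E hE =>
    (hRadon ω E (hI.isBounded_of_mem_supClosure hE)).ne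
  constructor
  · exact fun hM n _ B hB hBd => hM.negAssoc (fun i => hI.measurableSet _ (hB i))
      (fun i => hI.isBounded _ (hB i)) hBd
  · exact fun hM => NegAssocOn.rmNegAssoc hM hMmeas hI hfin
end

section
/- Let M be a random measure on a Polish space S and let 𝓘 be a countable topological dissecting semi-ring of bounded Borel sets generating the Borel σ-field of S. Then (M(B_1), …, M(B_n)) is negatively associated for all n ≥ 1 and all pairwise disjoint B_1, …, B_n ∈ 𝓘 if and only if (M(B_1), …, M(B_n)) is negatively associated for all n ≥ 1 and all pairwise disjoint bounded Borel sets B_1, …, B_n ⊂ S. -/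
open MeasureTheory

section NegativeAssociation

open Set Filter Topology
open scoped ENNReal symmDiff

/-- Two real random variables have nonpositive covariance. -/
def NonposCov {Ω : Type*} [MeasurableSpace Ω] (P : Measure Ω) (f g : Ω → ℝ) : Prop :=
  ∫ ω, f ω * g ω ∂P ≤ (∫ ω, f ω ∂P) * ∫ ω, g ω ∂P

section NonposCov

variable {Ω : Type*} [MeasurableSpace Ω] {P : Measure Ω}

lemma NonposCov.of_tendsto [IsProbabilityMeasure P] {F G : ℕ → Ω → ℝ} {f g : Ω → ℝ} {C : ℝ}
    (h : ∀ n, NonposCov P (F n) (G n))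
    (hFm : ∀ n, Measurable (F n)) (hGm : ∀ n, Measurable (G n))
    (hF : ∀ n ω, |F n ω| ≤ C) (hG : ∀ n ω, |G n ω| ≤ C)
    (hFf : ∀ᵐ ω ∂P, Tendsto (fun n => F n ω) atTop (𝓝 (f ω)))
    (hGg : ∀ᵐ ω ∂P, Tendsto (fun n => G n ω) atTop (𝓝 (g ω))) :
    NonposCov P f g := by
  refine le_of_tendsto_of_tendsto' (f := fun n => ∫ ω, F n ω * G n ω ∂P)
    (tendsto_integral_of_dominated_convergence (fun _ => C * C)
      (fun n => ((hFm n).mul (hGm n)).aestronglyMeasurable) (integrable_const _) ?_ ?_)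
    ((tendsto_integral_of_dominated_convergence (fun _ => C)
      (fun n => (hFm n).aestronglyMeasurable) (integrable_const _) ?_ hFf).mul
    (tendsto_integral_of_dominated_convergence (fun _ => C)
      (fun n => (hGm n).aestronglyMeasurable) (integrable_const _) ?_ hGg)) h
  · intro n
    refine ae_of_all _ fun ω => ?_
    rw [Real.norm_eq_abs, abs_mul]
    exact mul_le_mul (hF n ω) (hG n ω) (abs_nonneg _) ((abs_nonneg _).trans (hF n ω))
  · filter_upwards [hFf, hGg] with ω h1 h2 using h1.mul h2
  · exact fun n => ae_of_all _ (hF n)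
  · exact fun n => ae_of_all _ (hG n)

lemma NonposCov.affine [IsProbabilityMeasure P] {f g : Ω → ℝ} (h : NonposCov P f g)
    (hf : Integrable f P) (hg : Integrable g P) (hfg : Integrable (fun ω => f ω * g ω) P)
    {a c : ℝ} (ha : 0 ≤ a) (hc : 0 ≤ c) (b d : ℝ) :
    NonposCov P (fun ω => a * f ω + b) (fun ω => c * g ω + d) := by
  unfold NonposCov at *
  have e : ∀ ω, (a * f ω + b) * (c * g ω + d)
      = a * c * (f ω * g ω) + (a * d * f ω + (b * c * g ω + b * d)) := fun ω => by ring
  simp_rw [e]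
  rw [integral_add (hfg.const_mul _) (by fun_prop), integral_add (by fun_prop) (by fun_prop),
    integral_add (by fun_prop) (by fun_prop), integral_add (by fun_prop) (by fun_prop),
    integral_add (by fun_prop) (by fun_prop)]
  simp only [integral_const_mul, integral_const, probReal_univ, one_smul]
  nlinarith [mul_le_mul_of_nonneg_left h (mul_nonneg ha hc)]

lemma NonposCov.sum {κ κ' : Type*} {s : Finset κ} {t : Finset κ'} {F : κ → Ω → ℝ}
    {G : κ' → Ω → ℝ} (h : ∀ i j, NonposCov P (F i) (G j)) (hF : ∀ i, Integrable (F i) P)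
    (hG : ∀ j, Integrable (G j) P) (hFG : ∀ i j, Integrable (fun ω => F i ω * G j ω) P) :
    NonposCov P (fun ω => ∑ i ∈ s, F i ω) (fun ω => ∑ j ∈ t, G j ω) := by
  unfold NonposCov at *
  simp_rw [Finset.sum_mul_sum]
  rw [integral_finsetSum _ fun i _ => integrable_finsetSum _ fun j _ => hFG i j,
    integral_finsetSum _ fun i _ => hF i, integral_finsetSum _ fun i _ => hG i,
    Finset.sum_mul_sum]
  refine Finset.sum_le_sum fun i _ => ?_
  rw [integral_finsetSum _ fun j _ => hFG i j]
  exact Finset.sum_le_sum fun j _ => h i j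

end NonposCov

section Approximation

variable {ι : Type*}

lemma IsUpperSet.infEDist_antitone [Fintype ι] {E : Set (ι → Icc (0 : ℝ) 1)} (hE : IsUpperSet E) :
    Antitone fun x => Metric.infEDist x E := by
  intro x y hxy
  refine Metric.le_infEDist.2 fun z hz => ?_
  refine (Metric.infEDist_le_edist_of_mem (hE (le_sup_left (b := y)) hz)).trans ?_
  refine edist_pi_le_iff.2 fun i => (?_ : _ ≤ _).trans (edist_le_pi_edist x z i)
  rw [edist_dist, edist_dist]
  refine ENNReal.ofReal_le_ofReal ?_
  rw [Subtype.dist_eq, Subtype.dist_eq, Real.dist_eq, Real.dist_eq]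
  have h : (x i : ℝ) ≤ y i := hxy i
  rcases le_total (z i) (y i) with h' | h'
  · simp [Pi.sup_apply, sup_eq_right.2 h']
  · rw [Pi.sup_apply, sup_eq_left.2 h', abs_of_nonpos, abs_of_nonpos]
    · linarith
    · have : (y i : ℝ) ≤ z i := h'
      linarith
    · have : (y i : ℝ) ≤ z i := h'
      linarith

lemma IsUpperSet.exists_seq_continuous_tendsto_indicator [Finite ι] {K : Set (ι → ℝ≥0∞)}
    (hK : IsUpperSet K) (hKc : IsClosed K) :
    ∃ φ : ℕ → (ι → ℝ≥0∞) → ℝ,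
      (∀ n, Continuous (φ n) ∧ Monotone (φ n) ∧ ∀ x, φ n x ∈ Icc (0 : ℝ) 1) ∧
      ∀ x, Tendsto (fun n => φ n x) atTop (𝓝 (K.indicator (fun _ => 1) x)) := by
  have := Fintype.ofFinite ι
  let o := ENNReal.orderIsoUnitIntervalBirational
  let e : (ι → ℝ≥0∞) → (ι → Icc (0 : ℝ) 1) := fun x i => o (x i)
  let e' : (ι → Icc (0 : ℝ) 1) → (ι → ℝ≥0∞) := fun x i => o.symm (x i)
  have he : Continuous e := by
    have := o.continuous
    fun_prop
  have he' : Continuous e' := by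
    have := o.symm.continuous
    fun_prop
  have hee' : ∀ x, e' (e x) = x := fun x => by ext i; simp [e, e']
  have hE : IsUpperSet (e' ⁻¹' K) := fun x y hxy hx =>
    hK (fun i => o.symm.monotone (hxy i)) hx
  have hδ : ∀ n : ℕ, (0 : ℝ) < 1 / ((n : ℝ) + 1) := fun n => Nat.one_div_pos_of_nat
  refine ⟨fun n x => thickenedIndicator (hδ n) (e' ⁻¹' K) (e x), fun n => ⟨?_, ?_, ?_⟩, ?_⟩
  · fun_prop
  · intro x y hxy
    exact NNReal.coe_le_coe.2 (thickenedIndicator_mono_infEDist _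
      (hE.infEDist_antitone fun i => o.monotone (hxy i)))
  · exact fun x => ⟨NNReal.coe_nonneg _, NNReal.coe_le_one.2 (thickenedIndicator_le_one _ _ _)⟩
  · intro x
    have h := tendsto_pi_nhds.1 (thickenedIndicator_tendsto_indicator_closure hδ
      tendsto_one_div_add_atTop_nhds_zero_nat (e' ⁻¹' K)) (e x)
    rw [(hKc.preimage he').closure_eq] at h
    have hind : K.indicator (fun _ => (1 : ℝ)) x
        = ((e' ⁻¹' K).indicator (fun _ => (1 : NNReal)) (e x) : NNReal) := by
      by_cases hx : x ∈ K <;> simp [indicator, hee', hx]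
    rw [hind]
    exact (NNReal.continuous_coe.tendsto _).comp h

lemma isClosed_upperClosure_of_isClosed {F : Set (ι → ℝ≥0∞)} (hF : IsClosed F) :
    IsClosed (upperClosure F : Set (ι → ℝ≥0∞)) := by
  have h : IsClosed {p : (ι → ℝ≥0∞) × (ι → ℝ≥0∞) | p.1 ∈ F ∧ p.1 ≤ p.2} :=
    (hF.preimage continuous_fst).inter (isClosed_le continuous_fst continuous_snd)
  convert isClosedMap_snd_of_compactSpace _ h using 1
  ext y
  simp [mem_upperClosure]

lemma IsUpperSet.exists_seq_isClosed_ae [Finite ι] {μ : Measure (ι → ℝ≥0∞)} [IsFiniteMeasure μ]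
    {U : Set (ι → ℝ≥0∞)} (hU : IsUpperSet U) (hUm : MeasurableSet U) :
    ∃ K : ℕ → Set (ι → ℝ≥0∞), (∀ n, IsClosed (K n) ∧ IsUpperSet (K n)) ∧
      ∀ᵐ x ∂μ, Tendsto (fun n => (K n).indicator (fun _ => (1 : ℝ)) x) atTop
        (𝓝 (U.indicator (fun _ => 1) x)) := by
  have h : ∀ n : ℕ, ∃ F ⊆ U, IsClosed F ∧ μ (U \ F) < ((n : ℝ≥0∞) + 1)⁻¹ := fun n =>
    hUm.exists_isClosed_sdiff_lt (measure_ne_top _ _) (by simp)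
  choose F hFU hFc hF using h
  have hFU' : ∀ n, (upperClosure (F n) : Set (ι → ℝ≥0∞)) ⊆ U := fun n =>
    upperClosure_min (hFU n) hU
  let K := accumulate fun n => (upperClosure (F n) : Set (ι → ℝ≥0∞))
  have hKU : (⋃ n, K n) ⊆ U := by
    rw [iUnion_accumulate]
    exact iUnion_subset hFU'
  have h0 : μ (U \ ⋃ n, K n) = 0 := by
    refine le_antisymm (ge_of_tendsto' (f := fun n : ℕ => ((n : ℝ≥0∞) + 1)⁻¹) (x := atTop) ?_
      fun n => ?_) zero_le
    · have := (tendsto_add_atTop_iff_nat 1).2 ENNReal.tendsto_inv_nat_nhds_zero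
      simpa using this
    · refine (measure_mono ?_).trans (hF n).le
      have hFK : F n ⊆ K n := fun x hx =>
        mem_accumulate.2 ⟨n, le_rfl, subset_upperClosure hx⟩
      exact sdiff_subset_sdiff_right (hFK.trans (subset_iUnion K n))
  refine ⟨K, fun n => ⟨?_, ?_⟩, ?_⟩
  · exact (finite_le_nat n).isClosed_biUnion fun i _ => isClosed_upperClosure_of_isClosed (hFc i)
  · exact isUpperSet_iUnion₂ fun i _ => (upperClosure (F i)).upper
  · have : ∀ᵐ x ∂μ, x ∉ U \ ⋃ n, K n := measure_eq_zero_iff_ae_notMem.1 h0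
    filter_upwards [this] with x hx
    rw [tendsto_indicator_const_apply_iff_eventually]
    by_cases hxU : x ∈ U
    · obtain ⟨m, hm⟩ := mem_iUnion.1 (by_contra fun h => hx ⟨hxU, h⟩ : x ∈ ⋃ n, K n)
      filter_upwards [eventually_ge_atTop m] with n hn
      exact iff_of_true (monotone_accumulate hn hm) hxU
    · exact .of_forall fun n => iff_of_false (fun h => hxU (hKU (mem_iUnion_of_mem n h))) hxU

end Approximation

section Extension

universe u

variable {Ω : Type*} [MeasurableSpace Ω] {P : Measure Ω} [IsProbabilityMeasure P]
  {ι κ : Type u} {X : Ω → ι → ℝ≥0∞} {Y : Ω → κ → ℝ≥0∞}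

lemma nonposCov_indicator_of_continuous [Finite ι] [Finite κ] (hX : Measurable X)
    (hY : Measurable Y)
    (h : ∀ f g, Continuous f → Monotone f → (∀ x, f x ∈ Icc (0 : ℝ) 1) →
      Continuous g → Monotone g → (∀ y, g y ∈ Icc (0 : ℝ) 1) →
      NonposCov P (fun ω => f (X ω)) (fun ω => g (Y ω)))
    {U : Set (ι → ℝ≥0∞)} {V : Set (κ → ℝ≥0∞)} (hU : IsUpperSet U) (hUm : MeasurableSet U)
    (hV : IsUpperSet V) (hVm : MeasurableSet V) :
    NonposCov P (fun ω => U.indicator (fun _ => 1) (X ω))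
      (fun ω => V.indicator (fun _ => 1) (Y ω)) := by
  have habs : ∀ {α : Type u} (s : Set α) (x : α), |s.indicator (fun _ => (1 : ℝ)) x| ≤ 1 := by
    intro α s x
    by_cases hx : x ∈ s <;> simp [hx]
  have habs' : ∀ {a : ℝ}, a ∈ Icc (0 : ℝ) 1 → |a| ≤ 1 := fun ha =>
    abs_le.2 ⟨by linarith [ha.1], ha.2⟩
  have closed : ∀ (K : Set (ι → ℝ≥0∞)) (L : Set (κ → ℝ≥0∞)), IsUpperSet K → IsClosed K →
      IsUpperSet L → IsClosed L → NonposCov P (fun ω => K.indicator (fun _ => 1) (X ω))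
        (fun ω => L.indicator (fun _ => 1) (Y ω)) := by
    intro K L hK hKc hL hLc
    obtain ⟨φ, hφ, hφK⟩ := hK.exists_seq_continuous_tendsto_indicator hKc
    obtain ⟨ψ, hψ, hψL⟩ := hL.exists_seq_continuous_tendsto_indicator hLc
    exact NonposCov.of_tendsto (C := 1)
      (fun n => h (φ n) (ψ n) (hφ n).1 (hφ n).2.1 (hφ n).2.2 (hψ n).1 (hψ n).2.1 (hψ n).2.2)
      (fun n => (hφ n).1.measurable.comp hX) (fun n => (hψ n).1.measurable.comp hY)
      (fun n ω => habs' ((hφ n).2.2 _)) (fun n ω => habs' ((hψ n).2.2 _))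
      (ae_of_all _ fun ω => hφK _) (ae_of_all _ fun ω => hψL _)
  have := Measure.isProbabilityMeasure_map (μ := P) hX.aemeasurable
  have := Measure.isProbabilityMeasure_map (μ := P) hY.aemeasurable
  obtain ⟨K, hK, hKU⟩ := hU.exists_seq_isClosed_ae (μ := P.map X) hUm
  obtain ⟨L, hL, hLV⟩ := hV.exists_seq_isClosed_ae (μ := P.map Y) hVm
  exact NonposCov.of_tendsto (C := 1)
    (fun n => closed (K n) (L n) (hK n).2 (hK n).1 (hL n).2 (hL n).1)
    (fun n => (measurable_const.indicator (hK n).1.measurableSet).comp hX)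
    (fun n => (measurable_const.indicator (hL n).1.measurableSet).comp hY)
    (fun n ω => habs _ _) (fun n ω => habs _ _)
    (ae_of_ae_map hX.aemeasurable hKU) (ae_of_ae_map hY.aemeasurable hLV)

lemma natFloor_mul_eq_sum_indicator {α : Type*} (f : α → ℝ) (hf : ∀ x, f x ∈ Icc (0 : ℝ) 1)
    (n : ℕ) (x : α) :
    ((⌊(n : ℝ) * f x⌋₊ : ℕ) : ℝ)
      = ∑ i ∈ Finset.range n, {x | (i : ℝ) + 1 ≤ n * f x}.indicator (fun _ => (1 : ℝ)) x := by
  have h0 : 0 ≤ (n : ℝ) * f x := mul_nonneg n.cast_nonneg (hf x).1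
  have hle : ⌊(n : ℝ) * f x⌋₊ ≤ n :=
    Nat.floor_le_of_le (mul_le_of_le_one_right n.cast_nonneg (hf x).2)
  have h : ∀ i : ℕ, {x | (i : ℝ) + 1 ≤ n * f x}.indicator (fun _ => (1 : ℝ)) x
      = if i ∈ Finset.range ⌊(n : ℝ) * f x⌋₊ then 1 else 0 := by
    intro i
    have hi : i ∈ Finset.range ⌊(n : ℝ) * f x⌋₊ ↔ (i : ℝ) + 1 ≤ n * f x := by
      rw [Finset.mem_range, ← Nat.add_one_le_iff, Nat.le_floor_iff h0]
      simp
    simp only [hi, indicator, mem_ofPred]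
  simp_rw [h]
  rw [Finset.sum_ite_mem, Finset.inter_eq_right.2 (Finset.range_subset_range.2 hle)]
  simp

lemma nonposCov_of_indicator (hX : Measurable X) (hY : Measurable Y)
    (h : ∀ U V, IsUpperSet U → MeasurableSet U → IsUpperSet V → MeasurableSet V →
      NonposCov P (fun ω => U.indicator (fun _ => 1) (X ω))
        (fun ω => V.indicator (fun _ => 1) (Y ω)))
    {f : (ι → ℝ≥0∞) → ℝ} {g : (κ → ℝ≥0∞) → ℝ} (hf : Measurable f) (hfm : Monotone f)
    (hf1 : ∀ x, f x ∈ Icc (0 : ℝ) 1) (hg : Measurable g) (hgm : Monotone g)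
    (hg1 : ∀ y, g y ∈ Icc (0 : ℝ) 1) :
    NonposCov P (fun ω => f (X ω)) (fun ω => g (Y ω)) := by
  have upper : ∀ {α : Type u} [Preorder α] {k : α → ℝ} (_ : Monotone k) (n i : ℕ),
      IsUpperSet {x | (i : ℝ) + 1 ≤ n * k x} := fun hk n i x y hxy hx =>
    le_trans (mem_ofPred.1 hx) (mul_le_mul_of_nonneg_left (hk hxy) n.cast_nonneg)
  have meas : ∀ {α : Type u} [MeasurableSpace α] {k : α → ℝ} (_ : Measurable k) (n i : ℕ),
      MeasurableSet {x | (i : ℝ) + 1 ≤ n * k x} := fun hk n i =>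
    measurableSet_le measurable_const (hk.const_mul _)
  have int : ∀ {α : Type u} [MeasurableSpace α] {Z : Ω → α} (_ : Measurable Z) {s : Set α}
      (_ : MeasurableSet s), Integrable (fun ω => s.indicator (fun _ => (1 : ℝ)) (Z ω)) P :=
    fun hZ _ hs => (integrable_const (1 : ℝ)).indicator (hZ hs)
  have bdd : ∀ {k : ℝ} (_ : k ∈ Icc (0 : ℝ) 1) (n : ℕ), |(⌊(n : ℝ) * k⌋₊ : ℝ) / n| ≤ 1 := by
    intro k hk n
    rw [abs_of_nonneg (by positivity)]
    refine div_le_one_of_le₀ ?_ n.cast_nonneg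
    exact (Nat.floor_le (mul_nonneg n.cast_nonneg hk.1)).trans
      (mul_le_of_le_one_right n.cast_nonneg hk.2)
  have lim : ∀ {k : ℝ} (_ : k ∈ Icc (0 : ℝ) 1),
      Tendsto (fun n : ℕ => (⌊(n : ℝ) * k⌋₊ : ℝ) / n) atTop (𝓝 k) := by
    intro k hk
    have := (tendsto_nat_floor_mul_div_atTop hk.1).comp tendsto_natCast_atTop_atTop
    simpa [Function.comp_def, mul_comm] using this
  refine NonposCov.of_tendsto (C := 1)
    (F := fun n ω => (⌊(n : ℝ) * f (X ω)⌋₊ : ℝ) / n)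
    (G := fun n ω => (⌊(n : ℝ) * g (Y ω)⌋₊ : ℝ) / n) (fun n => ?_) ?_ ?_
    (fun n ω => bdd (hf1 _) n) (fun n ω => bdd (hg1 _) n) (ae_of_all _ fun ω => lim (hf1 _))
    (ae_of_all _ fun ω => lim (hg1 _))
  · have hint : ∀ i j : ℕ, Integrable (fun ω =>
        {x | (i : ℝ) + 1 ≤ n * f x}.indicator (fun _ => (1 : ℝ)) (X ω) *
        {y | (j : ℝ) + 1 ≤ n * g y}.indicator (fun _ => (1 : ℝ)) (Y ω)) P := fun i j => by
      refine (int hX (meas hf n i)).mul_bdd (c := 1) (int hY (meas hg n j)).1 (ae_of_all _ ?_)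
      intro ω
      by_cases hy : Y ω ∈ {y | (j : ℝ) + 1 ≤ n * g y} <;> simp [indicator, hy]
    have hsum := NonposCov.sum (s := Finset.range n) (t := Finset.range n)
      (fun i j : ℕ => h _ _ (upper hfm n i) (meas hf n i) (upper hgm n j) (meas hg n j))
      (fun i => int hX (meas hf n i)) (fun j => int hY (meas hg n j)) hint
    have haff := hsum.affine (integrable_finsetSum _ fun i _ => int hX (meas hf n i))
      (integrable_finsetSum _ fun j _ => int hY (meas hg n j))
      (by
        simp_rw [Finset.sum_mul_sum]
        exact integrable_finsetSum _ fun i _ => integrable_finsetSum _ fun j _ => hint i j)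
      (inv_nonneg.2 (n.cast_nonneg : (0 : ℝ) ≤ n)) (inv_nonneg.2 (n.cast_nonneg : (0 : ℝ) ≤ n)) 0 0
    simp_rw [natFloor_mul_eq_sum_indicator f hf1, natFloor_mul_eq_sum_indicator g hg1,
      div_eq_inv_mul]
    simpa using haff
  · exact fun n => by fun_prop
  · exact fun n => by fun_prop

lemma nonposCov_of_continuous [Finite ι] [Finite κ] (hX : Measurable X) (hY : Measurable Y)
    (h : ∀ f g, Continuous f → Monotone f → (∀ x, f x ∈ Icc (0 : ℝ) 1) →
      Continuous g → Monotone g → (∀ y, g y ∈ Icc (0 : ℝ) 1) →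
      NonposCov P (fun ω => f (X ω)) (fun ω => g (Y ω)))
    {f : (ι → ℝ≥0∞) → ℝ} {g : (κ → ℝ≥0∞) → ℝ} (hf : Measurable f) (hfm : Monotone f)
    (hfb : ∃ C, ∀ x, |f x| ≤ C) (hg : Measurable g) (hgm : Monotone g)
    (hgb : ∃ C, ∀ y, |g y| ≤ C) :
    NonposCov P (fun ω => f (X ω)) (fun ω => g (Y ω)) := by
  have pos : ∀ {α : Type u} {k : α → ℝ}, (∃ C, ∀ x, |k x| ≤ C) → ∃ C > 0, ∀ x, |k x| ≤ C :=
    fun ⟨C, hC⟩ => ⟨|C| + 1, by positivity,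
      fun x => (hC x).trans ((le_abs_self C).trans (by linarith))⟩
  obtain ⟨C, hC0, hC⟩ := pos hfb
  obtain ⟨D, hD0, hD⟩ := pos hgb
  have unit : ∀ {k C : ℝ}, 0 < C → |k| ≤ C → (k + C) / (2 * C) ∈ Icc (0 : ℝ) 1 := by
    intro k C hC hk
    have := abs_le.1 hk
    exact ⟨div_nonneg (by linarith) (by linarith), div_le_one_of_le₀ (by linarith) (by linarith)⟩
  have mono : ∀ {α : Type u} [Preorder α] {k : α → ℝ} {C : ℝ}, 0 < C → Monotone k →
      Monotone fun x => (k x + C) / (2 * C) := fun hC hk x y hxy =>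
    div_le_div_of_nonneg_right (by linarith [hk hxy]) (by linarith)
  have key := nonposCov_of_indicator (P := P) hX hY
    (fun U V hU hUm hV hVm => nonposCov_indicator_of_continuous hX hY h hU hUm hV hVm)
    (f := fun x => (f x + C) / (2 * C)) (g := fun y => (g y + D) / (2 * D))
    (by fun_prop) (mono hC0 hfm) (fun x => unit hC0 (hC x))
    (by fun_prop) (mono hD0 hgm) (fun y => unit hD0 (hD y))
  have bound : ∀ {a : ℝ}, a ∈ Icc (0 : ℝ) 1 → ‖a‖ ≤ 1 := fun ha =>
    abs_le.2 ⟨by linarith [ha.1], ha.2⟩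
  have hfi : Integrable (fun ω => (f (X ω) + C) / (2 * C)) P :=
    Integrable.of_bound (Measurable.aestronglyMeasurable (by fun_prop)) 1
      (ae_of_all _ fun ω => bound (unit hC0 (hC _)))
  have hgi : Integrable (fun ω => (g (Y ω) + D) / (2 * D)) P :=
    Integrable.of_bound (Measurable.aestronglyMeasurable (by fun_prop)) 1
      (ae_of_all _ fun ω => bound (unit hD0 (hD _)))
  have haff := key.affine hfi hgi
    (hfi.mul_bdd (c := 1) hgi.1 (ae_of_all _ fun ω => bound (unit hD0 (hD _))))
    (a := 2 * C) (c := 2 * D) (by positivity) (by positivity) (-C) (-D)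
  convert haff using 2
  · field_simp
    ring
  · field_simp
    ring

lemma NegAssoc.of_tendsto [Finite ι] {X : ℕ → ι → Ω → ℝ≥0∞} {Y : ι → Ω → ℝ≥0∞}
    (hX : ∀ k i, Measurable (X k i)) (hY : ∀ i, Measurable (Y i)) (h : ∀ k, NegAssoc P (X k))
    (hlim : ∀ᵐ ω ∂P, ∀ i, Tendsto (fun k => X k i ω) atTop (𝓝 (Y i ω))) : NegAssoc P Y := by
  intro J f g hf hfm hfb hg hgm hgb
  refine nonposCov_of_continuous (P := P) (X := fun ω (j : J) => Y j ω)
    (Y := fun ω (j : (Jᶜ : Set ι)) => Y j ω) (by fun_prop) (by fun_prop) ?_ hf hfm hfb hg hgm hgb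
  intro f g hf hfm hf1 hg hgm hg1
  have bound : ∀ {a : ℝ}, a ∈ Icc (0 : ℝ) 1 → |a| ≤ 1 := fun ha =>
    abs_le.2 ⟨by linarith [ha.1], ha.2⟩
  refine NonposCov.of_tendsto (C := 1) (F := fun k ω => f fun j => X k j.1 ω)
    (G := fun k ω => g fun j => X k j.1 ω)
    (fun k => h k J f g hf.measurable hfm ⟨1, fun x => bound (hf1 x)⟩ hg.measurable hgm
      ⟨1, fun x => bound (hg1 x)⟩)
    (fun k => hf.measurable.comp (by fun_prop)) (fun k => hg.measurable.comp (by fun_prop))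
    (fun k ω => bound (hf1 _)) (fun k ω => bound (hg1 _)) ?_ ?_
  · filter_upwards [hlim] with ω hω
    exact (hf.tendsto _).comp (tendsto_pi_nhds.2 fun j => hω j.1)
  · filter_upwards [hlim] with ω hω
    exact (hg.tendsto _).comp (tendsto_pi_nhds.2 fun j => hω j.1)

lemma NegAssoc.of_isEmpty [IsEmpty ι] (X : ι → Ω → ℝ≥0∞) : NegAssoc P X := by
  intro J f g _ _ _ _ _ _
  have hJ : ∀ ω, (fun j : J => X j.1 ω) = fun j => isEmptyElim j.1 := fun ω =>
    funext fun j => isEmptyElim j.1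
  have hJ' : ∀ ω, (fun j : (Jᶜ : Set ι) => X j.1 ω) = fun j => isEmptyElim j.1 := fun ω =>
    funext fun j => isEmptyElim j.1
  simp [hJ, hJ']

end Extension

lemma NegAssoc.sum_fiber {Ω ι κ : Type*} [MeasurableSpace Ω] {P : Measure Ω}
    [Fintype κ] [DecidableEq ι] {X : κ → Ω → ℝ≥0∞} (h : NegAssoc P X) (q : κ → ι) :
    NegAssoc P fun i ω => ∑ c : {c // q c = i}, X c ω := by
  intro J f g hf hfm hfb hg hgm hgb
  have hmem : ∀ {J : Set ι} (j : J) (c : {c // q c = j}), c.1 ∈ q ⁻¹' J := fun j c => by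
    rw [mem_preimage, c.2]
    exact j.2
  have key : ∀ {J : Set ι} {f : (J → ℝ≥0∞) → ℝ}, Measurable f → Monotone f →
      (∃ C, ∀ x, |f x| ≤ C) →
      Measurable (fun x : q ⁻¹' J → ℝ≥0∞ => f fun j => ∑ c : {c // q c = j}, x ⟨c, hmem j c⟩) ∧
      Monotone (fun x : q ⁻¹' J → ℝ≥0∞ => f fun j => ∑ c : {c // q c = j}, x ⟨c, hmem j c⟩) ∧
      ∃ C, ∀ x : q ⁻¹' J → ℝ≥0∞, |f fun j => ∑ c : {c // q c = j}, x ⟨c, hmem j c⟩| ≤ C :=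
    fun hf hfm hfb => ⟨hf.comp (by fun_prop),
      fun x y hxy => hfm fun j => Finset.sum_le_sum fun c _ => hxy _,
      hfb.imp fun C hC x => hC _⟩
  obtain ⟨hf', hfm', hfb'⟩ := key hf hfm hfb
  obtain ⟨hg', hgm', hgb'⟩ := key hg hgm hgb
  exact h (q ⁻¹' J) _ _ hf' hfm' hfb' hg' hgm' hgb'

section RandomMeasure

variable {Ω S : Type*} [MeasurableSpace Ω] [MeasurableSpace S] {P : Measure Ω}
  [IsProbabilityMeasure P] {M : Ω → Measure S} {C : Set (Set S)} {U : Set S}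

lemma exists_seq_symmDiff_inter_tendsto_zero (hM : Measurable M) (hC : IsSetSemiring C)
    (hCc : ∃ D ⊆ C, D.Countable ∧ ⋃₀ D = univ)
    (hCg : ‹MeasurableSpace S› = MeasurableSpace.generateFrom C)
    (hU : MeasurableSet U) (hMU : ∀ ω, M ω U < ∞) {B : Set S} (hB : MeasurableSet B) :
    ∃ R : ℕ → Set S, (∀ k, R k ∈ supClosure C) ∧
      ∀ᵐ ω ∂P, Tendsto (fun k => M ω ((R k ∆ B) ∩ U)) atTop (𝓝 0) := by
  have hMs : ∀ {s : Set S}, MeasurableSet s → Measurable fun ω => M ω s := fun hs =>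
    (Measure.measurable_coe hs).comp hM
  let w : Ω → ℝ≥0∞ := fun ω => (1 + M ω U)⁻¹
  have hw : Measurable w := (measurable_const.add (hMs hU)).inv
  let m : Measure S := ((P.withDensity w).bind M).restrict U
  have hm : ∀ {s : Set S}, MeasurableSet s → m s = ∫⁻ ω, M ω (s ∩ U) ∂(P.withDensity w) :=
    fun hs => by
      rw [Measure.restrict_apply hs, Measure.bind_apply (hs.inter hU) hM.aemeasurable]
  have hfin : IsFiniteMeasure m := ⟨by
    rw [hm MeasurableSet.univ, univ_inter,
      lintegral_withDensity_eq_lintegral_mul _ hw (hMs hU)]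
    refine (lintegral_mono (g := fun _ => 1) fun ω => ?_).trans_lt (by simp)
    rw [Pi.mul_apply, ← ENNReal.div_eq_inv_mul]
    exact ENNReal.div_le_of_le_mul (by rw [one_mul]; exact le_add_self)⟩
  obtain ⟨ε, hε0, hε⟩ := ENNReal.exists_pos_sum_of_countable' one_ne_zero ℕ
  have hR : ∀ k, ∃ R ∈ supClosure C, m (R ∆ B) < ε k := fun k => by
    obtain ⟨D, hDC, hDc, hD⟩ := hCc
    exact exists_measure_symmDiff_lt_of_generateFrom_isSetSemiring hC
      ⟨D, hDc, hDC, by simp [hD]⟩ hCg hB (hε0 k)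
  choose R hRC hRε using hR
  have hRm : ∀ k, MeasurableSet (R k) := fun k => by
    rw [hCg]
    exact measurableSet_generateFrom_of_mem_supClosure (hRC k)
  refine ⟨R, hRC, ?_⟩
  have hRBm : ∀ k, Measurable fun ω => M ω ((R k ∆ B) ∩ U) := fun k =>
    hMs (((hRm k).symmDiff hB).inter hU)
  have hsum : ∫⁻ ω, ∑' k, M ω ((R k ∆ B) ∩ U) ∂(P.withDensity w) ≠ ∞ := by
    rw [lintegral_tsum fun k => (hRBm k).aemeasurable]
    refine ((ENNReal.tsum_le_tsum fun k => ?_).trans_lt (hε.trans ENNReal.one_lt_top)).ne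
    rw [← hm ((hRm k).symmDiff hB)]
    exact (hRε k).le
  have hae := ae_lt_top (Measurable.tsum hRBm) hsum
  rw [ae_withDensity_iff hw] at hae
  filter_upwards [hae] with ω hω
  refine ENNReal.tendsto_atTop_zero_of_tsum_ne_top (hω ?_).ne
  exact ENNReal.inv_ne_zero.2 (ENNReal.add_ne_top.2 ⟨ENNReal.one_ne_top, (hMU ω).ne⟩)

lemma tendsto_measure_of_tendsto_measure_symmDiff {μ : Measure S} {R : ℕ → Set S} {B : Set S}
    (hB : μ B ≠ ∞) (h : Tendsto (fun k => μ (R k ∆ B)) atTop (𝓝 0)) :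
    Tendsto (fun k => μ (R k)) atTop (𝓝 (μ B)) := by
  have h1 : Tendsto (fun k => μ B - μ (R k ∆ B)) atTop (𝓝 (μ B)) := by
    simpa using ENNReal.Tendsto.sub (tendsto_const_nhds (x := μ B)) h (.inl hB)
  have h2 : Tendsto (fun k => μ B + μ (R k ∆ B)) atTop (𝓝 (μ B)) := by
    simpa using (tendsto_const_nhds (x := μ B)).add h
  refine tendsto_of_tendsto_of_tendsto_of_le_of_le h1 h2 (fun k => ?_) fun k => ?_
  · refine tsub_le_iff_right.2 ((measure_mono ?_).trans (measure_union_le _ _))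
    intro x hx
    by_cases hxR : x ∈ R k
    · exact .inl hxR
    · exact .inr (.inr ⟨hx, hxR⟩)
  · refine (measure_mono ?_).trans (measure_union_le _ _)
    intro x hx
    by_cases hxB : x ∈ B
    · exact .inl hxB
    · exact .inr (.inl ⟨hx, hxB⟩)

lemma exists_seq_disjoint_tendsto {ι : Type*} [Finite ι] (hM : Measurable M)
    (hC : IsSetSemiring C) (hCc : ∃ D ⊆ C, D.Countable ∧ ⋃₀ D = univ)
    (hCg : ‹MeasurableSpace S› = MeasurableSpace.generateFrom C)
    (hU : U ∈ supClosure C) (hMU : ∀ ω, M ω U < ∞) {B : ι → Set S}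
    (hB : ∀ i, MeasurableSet (B i)) (hBU : ∀ i, B i ⊆ U)
    (hBd : Pairwise (Function.onFun Disjoint B)) :
    ∃ R : ℕ → ι → Set S, (∀ k i, R k i ∈ supClosure C) ∧
      (∀ k, Pairwise (Function.onFun Disjoint (R k))) ∧
      ∀ᵐ ω ∂P, ∀ i, Tendsto (fun k => M ω (R k i)) atTop (𝓝 (M ω (B i))) := by
  classical
  have := Fintype.ofFinite ι
  have hUm : MeasurableSet U := by
    rw [hCg]
    exact measurableSet_generateFrom_of_mem_supClosure hU
  choose R hRC hR using fun i =>
    exists_seq_symmDiff_inter_tendsto_zero (P := P) hM hC hCc hCg hUm hMU (hB i)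
  have hring := hC.isSetRing_supClosure
  let T : ℕ → ι → Set S := fun k i => (R i k ∩ U) \ ⋃ j ∈ Finset.univ.erase i, R j k
  refine ⟨T, fun k i => ?_, fun k i j hij => ?_, ?_⟩
  · exact hring.sdiff_mem (hring.inter_mem (hRC i k) hU) (hring.biUnion_mem _ fun j _ => hRC j k)
  · refine Set.disjoint_left.2 fun x hxi hxj => hxj.2 ?_
    exact mem_biUnion (Finset.mem_coe.2 (Finset.mem_erase.2 ⟨hij, Finset.mem_univ i⟩)) hxi.1.1
  · filter_upwards [ae_all_iff.2 hR] with ω hω i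
    refine tendsto_measure_of_tendsto_measure_symmDiff
      ((measure_mono (hBU i)).trans_lt (hMU ω)).ne ?_
    have hsum : Tendsto (fun k => ∑ j, M ω ((R j k ∆ B j) ∩ U)) atTop (𝓝 0) := by
      simpa using tendsto_finsetSum Finset.univ fun j _ => hω j
    refine tendsto_of_tendsto_of_tendsto_of_le_of_le tendsto_const_nhds hsum
      (fun _ => zero_le) fun k => ?_
    refine (measure_mono ?_).trans (measure_iUnion_fintype_le _ _)
    rintro x (⟨⟨⟨hxR, hxU⟩, hxn⟩, hxB⟩ | ⟨hxB, hxT⟩)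
    · exact mem_iUnion_of_mem i ⟨.inl ⟨hxR, hxB⟩, hxU⟩
    · by_cases hxR : x ∈ R i k
      · have : x ∈ ⋃ j ∈ Finset.univ.erase i, R j k := by_contra fun h =>
          hxT ⟨⟨hxR, hBU i hxB⟩, h⟩
        simp only [mem_iUnion, Finset.mem_erase, Finset.mem_univ, and_true] at this
        obtain ⟨j, hji, hxj⟩ := this
        exact mem_iUnion_of_mem j
          ⟨.inl ⟨hxj, fun h => Set.disjoint_left.1 (hBd hji) h hxB⟩, hBU i hxB⟩
      · exact mem_iUnion_of_mem i ⟨.inr ⟨hxB, hxR⟩, hBU i hxB⟩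

lemma negAssoc_of_mem_supClosure {ι : Type*} [Finite ι] (hC : IsSetSemiring C)
    (hCm : ∀ A ∈ C, MeasurableSet A)
    (h : ∀ n : ℕ, 0 < n → ∀ A : Fin n → Set S, (∀ i, A i ∈ C) →
      Pairwise (Function.onFun Disjoint A) → NegAssoc P (fun i ω => M ω (A i)))
    {R : ι → Set S} (hR : ∀ i, R i ∈ supClosure C) (hRd : Pairwise (Function.onFun Disjoint R)) :
    NegAssoc P fun i ω => M ω (R i) := by
  classical
  have := Fintype.ofFinite ι
  choose p hp using fun i => hC.mem_supClosure_iff.1 (hR i)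
  let e := Fintype.equivFin (Σ i, (p i).parts)
  let part : (Σ i, (p i).parts) → Set S := fun s => s.2
  let A : Fin (Fintype.card (Σ i, (p i).parts)) → Set S := fun c => part (e.symm c)
  have hAC : ∀ c, A c ∈ C := fun c => hp _ (e.symm c).2.2
  have hAd : Pairwise (Function.onFun Disjoint A) := by
    intro c d hcd
    have hne : e.symm c ≠ e.symm d := e.symm.injective.ne hcd
    simp only [Function.onFun, A, part]
    generalize e.symm c = a at hne
    generalize e.symm d = b at hne
    obtain ⟨i, a⟩ := a
    obtain ⟨j, b⟩ := b
    by_cases hij : i = j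
    · subst hij
      exact (p i).disjoint a.2 b.2 fun hab => hne (by rw [Subtype.ext hab])
    · exact (hRd hij).mono ((p i).le a.2) ((p j).le b.2)
  have hA : NegAssoc P fun c ω => M ω (A c) := by
    rcases Nat.eq_zero_or_pos (Fintype.card (Σ i, (p i).parts)) with h0 | h0
    · have : IsEmpty (Fin (Fintype.card (Σ i, (p i).parts))) := by rw [h0]; infer_instance
      exact NegAssoc.of_isEmpty _
    · exact h _ h0 A hAC hAd
  have hsum := hA.sum_fiber fun c => (e.symm c).1
  convert hsum using 3 with i ω
  have hRi : R i = ⋃ c : {c // (e.symm c).1 = i}, A c := by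
    ext x
    rw [mem_iUnion, ← (p i).sup_parts]
    simp only [Finset.sup_set_eq_biUnion, mem_iUnion, id, exists_prop]
    constructor
    · rintro ⟨a, ha, hxa⟩
      exact ⟨⟨e ⟨i, a, ha⟩, by simp⟩, by
        simp only [A, e.symm_apply_apply]
        exact hxa⟩
    · rintro ⟨⟨c, rfl⟩, hxc⟩
      exact ⟨_, (e.symm c).2.2, hxc⟩
  rw [hRi, measure_iUnion (f := fun c : {c // (e.symm c).1 = i} => A c)
    (fun c d hcd => hAd (Subtype.coe_injective.ne hcd)) fun c => hCm _ (hAC c), tsum_fintype]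

end RandomMeasure

lemma IsDissectingSemiring.isSetSemiring_s11 {S : Type*} [MeasurableSpace S] [MetricSpace S]
    {I : Set (Set S)} (hI : IsDissectingSemiring I) : IsSetSemiring I where
  empty_mem := hI.empty_mem
  inter_mem := hI.inter_mem
  sdiff_eq_sUnion' := hI.diff_eq_disjoint_sUnion

end NegativeAssociation

/-- For a random measure `M` on a Polish space `S`, the random vectors
`(M (B 1), …, M (B n))` are negatively associated for all pairwise disjoint sets from a
countable topological dissecting semi-ring `I` of bounded Borel sets generating the Borel
σ-field if and only if they are negatively associated for all pairwise disjoint bounded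
Borel sets. -/
theorem negAssoc_on_semiring_iff_negAssoc_on_bounded_borel
    {Ω S : Type*} [MeasurableSpace Ω]
    [MetricSpace S] [CompleteSpace S] [SecondCountableTopology S]
    [MeasurableSpace S] [BorelSpace S]
    (P : Measure Ω) [IsProbabilityMeasure P]
    (M : Ω → Measure S) (hMmeas : Measurable M)
    (hRadon : ∀ ω, ∀ B : Set S, Bornology.IsBounded B → M ω B < ⊤)
    (I : Set (Set S)) (hI : IsDissectingSemiring I) :
    (∀ (n : ℕ), 0 < n → ∀ B : Fin n → Set S, (∀ i, B i ∈ I) →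
        Pairwise (Function.onFun Disjoint B) →
        NegAssoc P (fun i ω => M ω (B i))) ↔
      (∀ (n : ℕ), 0 < n → ∀ B : Fin n → Set S,
        (∀ i, MeasurableSet (B i)) → (∀ i, Bornology.IsBounded (B i)) →
        Pairwise (Function.onFun Disjoint B) →
        NegAssoc P (fun i ω => M ω (B i))) := by
  have hring := hI.isSetSemiring_s11.isSetRing_supClosure
  refine ⟨fun h n _ B hBm hBb hBd => ?_, fun h n hn B hB hBd =>
    h n hn B (fun i => hI.measurableSet _ (hB i)) (fun i => hI.isBounded _ (hB i)) hBd⟩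
  obtain ⟨F, hFI, hF⟩ := hI.isBounded_covered (⋃ i, B i) (Bornology.isBounded_iUnion.2 hBb)
  have hU : F.sup id ∈ supClosure I :=
    hring.finsetSup_mem fun A hA => subset_supClosure (hFI hA)
  have hFU : F.sup id = ⋃₀ (F : Set (Set S)) := by
    rw [Finset.sup_id_set_eq_sUnion]
  have hUb : Bornology.IsBounded (F.sup id) := by
    rw [hFU]
    exact (Bornology.isBounded_sUnion F.finite_toSet).2 fun A hA => hI.isBounded A (hFI hA)
  obtain ⟨D, hDI, hDc, hD⟩ := hI.isOpen_eq_sUnion Set.univ isOpen_univ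
  obtain ⟨R, hRI, hRd, hR⟩ := exists_seq_disjoint_tendsto (P := P) hMmeas hI.isSetSemiring_s11
    ⟨D, hDI, hDc, hD.symm⟩ hI.generateFrom_eq.symm hU (fun ω => hRadon ω _ hUb) hBm
    (fun i => (Set.subset_iUnion B i).trans (hF.trans hFU.ge)) hBd
  have hRm : ∀ k i, MeasurableSet (R k i) := fun k i => by
    rw [← hI.generateFrom_eq]
    exact measurableSet_generateFrom_of_mem_supClosure (hRI k i)
  exact NegAssoc.of_tendsto (X := fun k i ω => M ω (R k i))
    (fun k i => (Measure.measurable_coe (hRm k i)).comp hMmeas)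
    (fun i => (Measure.measurable_coe (hBm i)).comp hMmeas)
    (fun k => negAssoc_of_mem_supClosure hI.isSetSemiring_s11 hI.measurableSet h (hRI k) (hRd k)) hR
end
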